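/- arXiv:1512.04978 — 2 statements merged into one kernel-verified Lean document; each statement's English description precedes it below -/
import Mathlib

section
/- Let q be odd and n ≡ 2 (mod 4), and let g ∈ SO_n^±(q). Then the following are equivalent: (1) g is real in SO_n^±(q); (2) g is strongly real in SO_n^±(q); (3) g has an elementary divisor of the form (t−1)^k or (t+1)^k with k odd. -/
section Helpers
open Module

lemma det_surj {F V V' : Type*} [Field F] [AddCommGroup V] [Module F V] [FiniteDimensional F V]
    [AddCommGroup V'] [Module F V'] (π : V →ₗ[F] V') (hπ : Function.Surjective π)
    (h : V →ₗ[F] V) (h' : V' →ₗ[F] V') (hc : ∀ x, π (h x) = h' (π x))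
    (hk : LinearMap.ker π ≤ (LinearMap.ker π).comap h) :
    LinearMap.det h = LinearMap.det (h.restrict hk) * LinearMap.det h' := by
  rw [LinearMap.det_eq_det_mul_det (LinearMap.ker π) h hk]
  congr 1
  rw [← LinearMap.det_conj _ (π.quotKerEquivOfSurjective hπ)]
  congr 1
  ext y
  obtain ⟨x, rfl⟩ := hπ y
  have : (π.quotKerEquivOfSurjective hπ).symm (π x) = (LinearMap.ker π).mkQ x := by
    rw [LinearEquiv.symm_apply_eq]; rfl
  simp only [LinearMap.comp_apply, LinearEquiv.coe_coe, this]
  simp [hc, LinearMap.quotKerEquivOfSurjective]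

lemma det_restrict_congr {F V V' : Type*} [Field F] [AddCommGroup V] [Module F V]
    [AddCommGroup V'] [Module F V'] (e : V ≃ₗ[F] V') (h : V →ₗ[F] V) (h' : V' →ₗ[F] V')
    (hc : ∀ x, e (h x) = h' (e x)) : LinearMap.det h = LinearMap.det h' := by
  rw [← LinearMap.det_conj h e]
  congr 1
  ext y
  simp [hc]

lemma red {F V : Type*} [Field F] [AddCommGroup V] [Module F V] [FiniteDimensional F V]
    (B : LinearMap.BilinForm F V) (nd : ∀ x, (∀ y, B x y = 0) → x = 0)
    (δ : F) (hs : ∀ x y, B x y = δ * B y x)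
    (h : V →ₗ[F] V) (c : F) (hc0 : c ≠ 0) (hc : ∀ x y, B (h x) (h y) = c * B x y)
    (U : Submodule F V) (hiso : U ≤ B.orthogonal U) (hU : ∀ x ∈ U, h x ∈ U) :
    ∃ (B' : LinearMap.BilinForm F (B.orthogonal U ⧸ U.comap (B.orthogonal U).subtype))
      (h' : (B.orthogonal U ⧸ U.comap (B.orthogonal U).subtype) →ₗ[F]
        (B.orthogonal U ⧸ U.comap (B.orthogonal U).subtype)),
      (∀ x y : B.orthogonal U, B' (Submodule.Quotient.mk x) (Submodule.Quotient.mk y) = B x y) ∧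
      (∀ x : B.orthogonal U, ∃ hx : h x ∈ B.orthogonal U,
        h' (Submodule.Quotient.mk x) = Submodule.Quotient.mk ⟨h x, hx⟩) ∧
      (∀ z, (∀ w, B' z w = 0) → z = 0) ∧
      LinearMap.det h = c ^ (finrank F U) * LinearMap.det h' ∧
      finrank F V = 2 * finrank F U +
        finrank F (B.orthogonal U ⧸ U.comap (B.orthogonal U).subtype) := by
  have hrefl : B.IsRefl := fun x y hxy => by rw [hs, hxy, mul_zero]
  have hnd : B.Nondegenerate := ⟨nd, fun y hy => nd y fun x => by rw [hs, hy, mul_zero]⟩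
  have hoo := LinearMap.BilinForm.orthogonal_orthogonal hnd hrefl U
  have hinj : Function.Injective h := by
    rw [injective_iff_map_eq_zero]
    intro x hx
    apply nd
    intro y
    have := hc x y
    rw [hx] at this
    simpa [hc0] using this.symm
  set Q := B.orthogonal U with hQdef
  have hUr : ∀ u ∈ U, ∃ u' ∈ U, h u' = u := by
    have hi : Function.Injective (h.restrict hU) := by
      intro a b hab
      exact Subtype.ext (hinj (congrArg Subtype.val hab))
    have hsu := LinearMap.injective_iff_surjective.mp hi
    intro u hu
    obtain ⟨u', hu'⟩ := hsu ⟨u, hu⟩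
    exact ⟨u', u'.2, congrArg Subtype.val hu'⟩
  have hQ : ∀ x ∈ Q, h x ∈ Q := by
    intro x hx
    rw [hQdef, LinearMap.BilinForm.mem_orthogonal_iff] at hx ⊢
    intro u hu
    obtain ⟨u', hu', rfl⟩ := hUr u hu
    have := hx u' hu'
    rw [hc, this, mul_zero]
  have hUQ0 : ∀ u ∈ U, ∀ x ∈ Q, B u x = 0 := fun u hu x hx =>
    (LinearMap.BilinForm.mem_orthogonal_iff.mp hx) u hu
  have hUQ1 : ∀ u ∈ U, ∀ x ∈ Q, B x u = 0 := fun u hu x hx => hrefl _ _ (hUQ0 u hu x hx)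
  set U' := U.comap Q.subtype with hU'
  obtain ⟨s, hsec⟩ := LinearMap.exists_rightInverse_of_surjective U'.mkQ (by simp)
  have hsec' : ∀ x : Q, ((s (Submodule.Quotient.mk x) : Q) : V) - x ∈ U := by
    intro x
    have h1 : U'.mkQ (s (Submodule.Quotient.mk x)) = U'.mkQ x := by
      have := LinearMap.congr_fun hsec (Submodule.Quotient.mk x)
      simpa using this
    have h2 := (Submodule.Quotient.eq U').mp h1
    simpa [hU'] using h2
  have hB' : ∀ x y : Q, B (s (Submodule.Quotient.mk x) : Q) (s (Submodule.Quotient.mk y) : Q)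
      = B x y := by
    intro x y
    have e1 : B (s (Submodule.Quotient.mk x) : Q) (s (Submodule.Quotient.mk y) : Q)
      = B x y + B ((s (Submodule.Quotient.mk x) : Q) - x : V) (s (Submodule.Quotient.mk y) : Q)
        + B x ((s (Submodule.Quotient.mk y) : Q) - y : V) := by
      simp only [map_sub, LinearMap.sub_apply]; ring
    rw [e1, hUQ0 _ (hsec' x) _ (s _).2, hUQ1 _ (hsec' y) _ x.2]; ring
  let hQm : Q →ₗ[F] Q := h.restrict hQ
  have hU'Q : U' ≤ U'.comap hQm := fun x hx => hU _ hx
  let h' := U'.mapQ U' hQm hU'Q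
  refine ⟨B.comp (Q.subtype ∘ₗ s) (Q.subtype ∘ₗ s), h', ?_, ?_, ?_, ?_, ?_⟩
  · intro x y
    exact hB' x y
  · intro x
    exact ⟨hQ x x.2, rfl⟩
  · intro z hz
    obtain ⟨x, rfl⟩ := U'.mkQ_surjective z
    have : (x : V) ∈ B.orthogonal Q := by
      rw [LinearMap.BilinForm.mem_orthogonal_iff]
      intro y hy
      have := hz (Submodule.Quotient.mk ⟨y, hy⟩)
      have := (hB' x ⟨y, hy⟩).symm.trans this
      exact hrefl _ _ this
    rw [hoo] at this
    simpa [hU'] using this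
  · -- determinant
    have e1 : LinearMap.det hQm = LinearMap.det (hQm.restrict hU'Q) * LinearMap.det h' :=
      LinearMap.det_eq_det_mul_det U' hQm hU'Q
    have e2 : LinearMap.det (hQm.restrict hU'Q) = LinearMap.det (h.restrict hU) :=
      det_restrict_congr (Submodule.comapSubtypeEquivOfLe hiso) _ _ (fun x => rfl)
    let β : V →ₗ[F] Module.Dual F U := U.subtype.dualMap ∘ₗ B
    have hβ : ∀ x (u : U), β x u = B x u := fun x u => rfl
    have hβk : LinearMap.ker β = Q := by
      ext x
      rw [LinearMap.mem_ker, hQdef, LinearMap.BilinForm.mem_orthogonal_iff]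
      constructor
      · intro hx u hu
        exact hrefl _ _ (LinearMap.congr_fun hx ⟨u, hu⟩)
      · intro hx
        ext u
        exact hrefl _ _ (hx u u.2)
    have hβs : Function.Surjective β := by
      have h1 : Function.Injective B := by
        rw [injective_iff_map_eq_zero]
        intro x hx
        exact nd x (fun y => by rw [hx]; rfl)
      have h2 : Function.Surjective (B : V →ₗ[F] Module.Dual F V) :=
        (LinearMap.injective_iff_surjective_of_finrank_eq_finrank
          (Subspace.dual_finrank_eq).symm).mp h1
      exact (LinearMap.dualMap_surjective_of_injective U.injective_subtype).comp h2
    have hi : Function.Injective (h.restrict hU) := by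
      intro a b hab
      exact Subtype.ext (hinj (congrArg Subtype.val hab))
    let hUe : U ≃ₗ[F] U := LinearEquiv.ofInjectiveEndo (h.restrict hU) hi
    have hUe' : ∀ u, hUe u = (h.restrict hU) u := fun u => rfl
    let k : Module.Dual F U →ₗ[F] Module.Dual F U := c • (hUe.symm : U →ₗ[F] U).dualMap
    have hk : ∀ x, β (h x) = k (β x) := by
      intro x
      ext u
      obtain ⟨u', rfl⟩ := hUe.surjective u
      have : β (h x) (hUe u') = B (h x) (h u') := rfl
      rw [this, hc]
      simp [k, hβ]
    have e3 := det_surj β hβs h k hk (by rw [hβk]; exact hQ)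
    have e4 : LinearMap.det (h.restrict (p := LinearMap.ker β) (q := LinearMap.ker β)
        (by rw [hβk]; exact hQ)) = LinearMap.det hQm :=
      det_restrict_congr (LinearEquiv.ofEq _ _ hβk) _ _ (fun x => rfl)
    rw [e4, e1, e2] at e3
    have e5 : LinearMap.det k = c ^ finrank F U * LinearMap.det (hUe.symm : U →ₗ[F] U) := by
      rw [LinearMap.det_smul, LinearMap.det_dualMap, Subspace.dual_finrank_eq]
    have e6 : LinearMap.det (h.restrict hU) * LinearMap.det (hUe.symm : U →ₗ[F] U) = 1 :=
      LinearEquiv.det_mul_det_symm hUe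
    rw [e3, e5]
    linear_combination (c ^ finrank F U * LinearMap.det h') * e6
  · have f1 := LinearMap.BilinForm.finrank_orthogonal hnd U
    have f2 := Submodule.finrank_quotient_add_finrank U'
    have f3 : finrank F U' = finrank F U := (Submodule.comapSubtypeEquivOfLe hiso).finrank_eq
    have f4 := Submodule.finrank_le U
    rw [← hQdef] at f1
    omega

lemma pf_closed {F : Type*} [Field F] [IsAlgClosed F] (c : F) (hc0 : c ≠ 0) :
    ∀ (d : ℕ) (V : Type*) [AddCommGroup V] [Module F V] [FiniteDimensional F V]
    (B : LinearMap.BilinForm F V) (_ : ∀ x, (∀ y, B x y = 0) → x = 0)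
    (_ : ∀ x, B x x = 0) (h : V →ₗ[F] V) (_ : ∀ x y, B (h x) (h y) = c * B x y),
    finrank F V = d → ∃ m, d = 2 * m ∧ LinearMap.det h = c ^ m := by
  intro d
  induction d using Nat.strong_induction_on with
  | _ d ih =>
  intro V _ _ _ B nd alt h hc hd
  rcases Nat.eq_zero_or_pos d with h0 | hpos
  · refine ⟨0, by omega, ?_⟩
    rw [LinearMap.det_eq_one_of_finrank_eq_zero (by omega)]; simp
  have : Nontrivial V := Module.nontrivial_of_finrank_pos (R := F) (by omega)
  obtain ⟨μ, hμ⟩ := Module.End.exists_eigenvalue (K := F) h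
  obtain ⟨v, hv⟩ := hμ.exists_hasEigenvector
  have hv1 : h v = μ • v := hv.apply_eq_smul
  have hs : ∀ x y, B x y = (-1) * B y x := by
    intro x y
    have := alt (x + y)
    simp only [map_add, LinearMap.add_apply, alt] at this
    linear_combination this
  obtain ⟨B', h', p1, p2, p3, p4, p5⟩ := red B nd (-1) hs h c hc0 hc (F ∙ v)
    (by
      rw [Submodule.span_singleton_le_iff_mem, LinearMap.BilinForm.mem_orthogonal_iff]
      intro n hn
      obtain ⟨a, rfl⟩ := Submodule.mem_span_singleton.mp hn
      simp [alt])
    (by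
      intro x hx
      obtain ⟨a, rfl⟩ := Submodule.mem_span_singleton.mp hx
      rw [map_smul, hv1, smul_smul]
      exact Submodule.smul_mem _ _ (Submodule.mem_span_singleton_self v))
  rw [finrank_span_singleton hv.2] at p4 p5
  obtain ⟨m, hm1, hm2⟩ := ih _ (by omega) _ B' p3
    (by
      intro z
      obtain ⟨x, rfl⟩ := Submodule.mkQ_surjective _ z
      exact (p1 x x).trans (alt _)) h'
    (by
      intro z w
      obtain ⟨x, rfl⟩ := Submodule.mkQ_surjective _ z
      obtain ⟨y, rfl⟩ := Submodule.mkQ_surjective _ w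
      obtain ⟨hx, ex⟩ := p2 x
      obtain ⟨hy, ey⟩ := p2 y
      simp only [Submodule.mkQ_apply]
      rw [ex, ey, p1, p1, hc]) rfl
  refine ⟨m + 1, by omega, ?_⟩
  rw [p4, hm2]; ring

lemma pf {F V : Type*} [Field F] [AddCommGroup V] [Module F V] [FiniteDimensional F V]
    (h2 : (2 : F) ≠ 0) (c : F) (hc0 : c ≠ 0)
    (B : LinearMap.BilinForm F V) (nd : ∀ x, (∀ y, B x y = 0) → x = 0)
    (skew : ∀ x y, B x y = - B y x) (h : V →ₗ[F] V) (hc : ∀ x y, B (h x) (h y) = c * B x y) :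
    ∃ m, finrank F V = 2 * m ∧ LinearMap.det h = c ^ m := by
  let b := Module.finBasis F V
  let n := finrank F V
  let K := AlgebraicClosure F
  let φ : F →+* K := algebraMap F K
  have hφ : Function.Injective φ := φ.injective
  let Ω : Matrix (Fin n) (Fin n) F := LinearMap.BilinForm.toMatrix b B
  let H : Matrix (Fin n) (Fin n) F := LinearMap.toMatrix b b h
  have hnd : B.Nondegenerate := ⟨nd, fun y hy => nd y fun x => by rw [skew, hy, neg_zero]⟩
  have hΩ : Ω.det ≠ 0 := (LinearMap.BilinForm.nondegenerate_iff_det_ne_zero b).mp hnd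
  have hΩs : Ω.transpose = -Ω := by
    ext i j
    simp [Ω, LinearMap.BilinForm.toMatrix_apply]
    exact skew _ _
  have hH : H.transpose * Ω * H = c • Ω := by
    have : B.comp h h = c • B := by
      ext x y; simp [hc]
    have h3 := congrArg (LinearMap.BilinForm.toMatrix b) this
    rw [LinearMap.BilinForm.toMatrix_comp b b, map_smul] at h3
    exact h3
  let Ωk := Ω.map φ
  let Hk := H.map φ
  have hΩk : Ωk.det ≠ 0 := by
    have : Ωk.det = φ Ω.det := (RingHom.map_det φ Ω).symm
    rw [this]; exact fun h0 => hΩ (hφ (by rw [h0, map_zero]))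
  have hΩks : Ωk.transpose = -Ωk := by
    have := congrArg (fun M => M.map φ) hΩs
    ext i j
    have := congrFun (congrFun this i) j
    simpa [Ωk] using this
  have hHk : Hk.transpose * Ωk * Hk = φ c • Ωk := by
    have := congrArg (fun M => M.map φ) hH
    simp only [Matrix.map_mul, Matrix.transpose_map] at this
    rw [this]
    ext i j
    simp [Ωk]
  let Bk : LinearMap.BilinForm K (Fin n → K) := Matrix.toBilin' Ωk
  have hBk : ∀ x y, Bk x y = x ⬝ᵥ Ωk.mulVec y := fun x y => Matrix.toBilin'_apply' _ _ _
  have hskewk : ∀ x y, Bk x y = - Bk y x := by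
    intro x y
    rw [hBk, hBk, Matrix.dotProduct_mulVec, ← Matrix.mulVec_transpose, hΩks,
      dotProduct_comm, Matrix.neg_mulVec, dotProduct_neg]
  have hndk : Bk.Nondegenerate := by
    exact (Matrix.nondegenerate_of_det_ne_zero hΩk).toBilin'
  obtain ⟨m, hm1, hm2⟩ := pf_closed (φ c) (fun h0 => hc0 (hφ (by rw [h0, map_zero]))) n
    (Fin n → K) Bk hndk.1 (by
      intro x
      have := hskewk x x
      have h2k : (2 : K) ≠ 0 := fun h0 => h2 (hφ (by rw [map_ofNat, map_zero]; exact h0))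
      have h4 : 2 * Bk x x = 0 := by linear_combination this
      exact (mul_eq_zero.mp h4).resolve_left h2k)
    (Matrix.toLin' Hk) (by
      intro x y
      rw [hBk, hBk, Matrix.toLin'_apply, Matrix.toLin'_apply, ← smul_eq_mul, ← dotProduct_smul,
        ← Matrix.smul_mulVec, ← hHk, ← Matrix.vecMul_transpose, ← Matrix.dotProduct_mulVec,
        Matrix.mulVec_mulVec, Matrix.mulVec_mulVec, Matrix.mul_assoc]) (by simp)
  refine ⟨m, hm1, hφ ?_⟩
  rw [LinearMap.det_toLin'] at hm2
  rw [map_pow, ← hm2, ← LinearMap.det_toMatrix b]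
  exact RingHom.map_det φ H

lemma adj_range {F V : Type*} [Field F] [AddCommGroup V] [Module F V] [FiniteDimensional F V]
    (B : LinearMap.BilinForm F V) (nd : ∀ x, (∀ y, B x y = 0) → x = 0)
    (hs : ∀ x y, B x y = B y x) (T T' : V →ₗ[F] V) (hT : ∀ x y, B (T x) y = B x (T' y))
    (z : V) (hz : ∀ x, T' x = 0 → B x z = 0) : ∃ w, T w = z := by
  have hrefl : B.IsRefl := fun x y hxy => by rw [hs, hxy]
  have hnd : B.Nondegenerate := ⟨nd, fun y hy => nd y fun x => by rw [hs, hy]⟩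
  have hoo := LinearMap.BilinForm.orthogonal_orthogonal hnd hrefl (LinearMap.range T)
  have : z ∈ LinearMap.range T := by
    rw [← hoo, LinearMap.BilinForm.mem_orthogonal_iff]
    intro x hx
    rw [LinearMap.BilinForm.mem_orthogonal_iff] at hx
    apply hz
    apply nd
    intro w
    rw [hs, ← hT]
    exact hx _ ⟨w, rfl⟩
  exact this

lemma even_rank {F V : Type*} [Field F] [AddCommGroup V] [Module F V] [FiniteDimensional F V]
    (h2 : (2 : F) ≠ 0)
    (B : LinearMap.BilinForm F V) (nd : ∀ x, (∀ y, B x y = 0) → x = 0)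
    (hs : ∀ x y, B x y = B y x) (N : V →ₗ[F] V) (hN : ∀ x y, B (N x) y = - B x (N y)) :
    ∃ m, finrank F V = 2 * m + finrank F (LinearMap.ker N) := by
  obtain ⟨s, hsec⟩ := LinearMap.exists_rightInverse_of_surjective (LinearMap.ker N).mkQ (by simp)
  have hsN : ∀ y, N (s ((LinearMap.ker N).mkQ y)) = N y := by
    intro y
    have h1 : (LinearMap.ker N).mkQ (s ((LinearMap.ker N).mkQ y)) = (LinearMap.ker N).mkQ y :=
      LinearMap.congr_fun hsec ((LinearMap.ker N).mkQ y)
    have h2 := (Submodule.Quotient.eq _).mp h1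
    rwa [LinearMap.mem_ker, map_sub, sub_eq_zero] at h2
  obtain ⟨m, hm, -⟩ := pf h2 1 one_ne_zero (B.comp s (N ∘ₗ s))
    (by
      intro z hz
      have h1 : N (s z) = 0 := by
        apply nd
        intro y
        have := hz ((LinearMap.ker N).mkQ y)
        simp only [LinearMap.BilinForm.comp_apply, LinearMap.comp_apply, hsN] at this
        rw [hN, this, neg_zero]
      obtain ⟨x, rfl⟩ := (LinearMap.ker N).mkQ_surjective z
      rw [hsN] at h1
      simpa using h1)
    (by
      intro x y
      simp only [LinearMap.BilinForm.comp_apply, LinearMap.comp_apply]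
      rw [hs, hN]) LinearMap.id (by intro x y; simp)
  have := Submodule.finrank_quotient_add_finrank (LinearMap.ker N)
  exact ⟨m, by omega⟩

lemma detB {F : Type*} [Field F] (h2 : (2 : F) ≠ 0) :
    ∀ (d : ℕ) (V : Type*) [AddCommGroup V] [Module F V] [FiniteDimensional F V]
    (B : LinearMap.BilinForm F V) (_ : ∀ x, (∀ y, B x y = 0) → x = 0)
    (_ : ∀ x y, B x y = B y x) (h N : V →ₗ[F] V) (_ : ∀ x y, B (h x) (h y) = B x y)
    (_ : ∀ x y, B (N x) y = - B x (N y)) (_ : ∀ x, h (N x) = - N (h x))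
    (_ : ∀ j, Even j → ∀ z, N ((N ^ j) z) = 0 → ∃ w, (N ^ j) z = (N ^ (j + 1)) w),
    finrank F V = d → ∀ m, d = 2 * m → LinearMap.det h = (-1) ^ m := by
  intro d
  induction d using Nat.strong_induction_on with
  | _ d ih =>
  intro V _ _ _ B nd hs h N hh hN hhN hE hd m hm
  by_cases hk : LinearMap.ker N = ⊥
  · obtain ⟨m', hm1, hm2⟩ := pf h2 (-1) (by simp) (B.comp LinearMap.id N)
      (by
        intro x hx
        have : N x = 0 := by
          apply nd
          intro y
          have := hx y
          simp only [LinearMap.BilinForm.comp_apply, LinearMap.id_apply] at this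
          rw [hN, this, neg_zero]
        exact (LinearMap.ker_eq_bot'.mp hk) x this)
      (by
        intro x y
        simp only [LinearMap.BilinForm.comp_apply, LinearMap.id_apply]
        rw [hs, hN]) h
      (by
        intro x y
        simp only [LinearMap.BilinForm.comp_apply, LinearMap.id_apply]
        have : N (h y) = - h (N y) := by rw [hhN, neg_neg]
        rw [this, map_neg, hh]; ring)
    have : m' = m := by omega
    rw [hm2, this]
  have hker : ∀ x, N x = 0 → ∃ w, x = N w := by
    intro x hx
    obtain ⟨w, hw⟩ := hE 0 (by simp) x (by simpa using hx)
    exact ⟨w, by simpa using hw⟩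
  set U := LinearMap.ker N with hUdef
  obtain ⟨B', h', p1, p2, p3, p4, p5⟩ := red B nd 1 (by intro x y; rw [one_mul, hs]) h 1 one_ne_zero
    (by intro x y; rw [hh, one_mul]) U
    (by
      intro x hx
      rw [LinearMap.BilinForm.mem_orthogonal_iff]
      intro y hy
      obtain ⟨w, rfl⟩ := hker x hx
      have : N y = 0 := hy
      have h3 := hN y w
      rw [this] at h3
      simpa using h3.symm)
    (by
      intro x hx
      have : N x = 0 := hx
      have h3 := hhN x
      rw [this, map_zero] at h3
      exact neg_eq_zero.mp h3.symm)
  have hUpos : 0 < finrank F U := by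
    rw [Nat.pos_iff_ne_zero]
    intro h0
    exact hk (Submodule.finrank_eq_zero.mp h0)
  obtain ⟨r, hr⟩ := even_rank h2 B nd hs N hN
  rw [← hUdef] at hr
  have hrange : ∀ x, N x ∈ B.orthogonal U := by
    intro x
    rw [LinearMap.BilinForm.mem_orthogonal_iff]
    intro y hy
    have : N y = 0 := hy
    have h3 := hN y x
    rw [this] at h3
    simpa using h3.symm
  have hQ : ∀ z ∈ B.orthogonal U, ∃ w, N w = z := by
    intro z hz
    rw [LinearMap.BilinForm.mem_orthogonal_iff] at hz
    refine adj_range B nd hs N (-N) (by intro x y; simp [hN]) z ?_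
    intro x hx
    exact hz x (by simpa [hUdef] using hx)
  let NQ : (B.orthogonal U) →ₗ[F] (B.orthogonal U) := N.restrict (fun x _ => hrange x)
  have hNQ : ∀ x : (B.orthogonal U), (NQ x : V) = N x := fun x => rfl
  let N' := (U.comap (B.orthogonal U).subtype).mapQ (U.comap (B.orthogonal U).subtype) NQ (by
    intro x hx
    have : N (x : V) = 0 := hx
    have h3 : NQ x = 0 := Subtype.ext this
    rw [Submodule.mem_comap, h3]
    exact zero_mem _)
  have hN' : ∀ x : (B.orthogonal U), N' (Submodule.Quotient.mk x) = Submodule.Quotient.mk (NQ x) := fun x => rfl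
  have hN'j : ∀ j (x : (B.orthogonal U)), (N' ^ j) (Submodule.Quotient.mk x) =
      Submodule.Quotient.mk ((NQ ^ j) x) := by
    intro j x
    induction j with
    | zero => rfl
    | succ j ihj => rw [pow_succ', pow_succ', Module.End.mul_apply, Module.End.mul_apply, ihj, hN']
  have hNQj : ∀ j (x : (B.orthogonal U)), ((NQ ^ j) x : V) = (N ^ j) x := by
    intro j x
    induction j with
    | zero => rfl
    | succ j ihj => rw [pow_succ', pow_succ', Module.End.mul_apply, Module.End.mul_apply, hNQ, ihj]
  have hmk : ∀ x y : (B.orthogonal U), (Submodule.Quotient.mk x : (B.orthogonal U) ⧸ U.comap (B.orthogonal U).subtype) = Submodule.Quotient.mk y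
      ↔ N x = N y := by
    intro x y
    rw [Submodule.Quotient.eq, Submodule.mem_comap]
    have : ((B.orthogonal U).subtype (x - y) ∈ U) ↔ N ((x : V) - y) = 0 := Iff.rfl
    rw [this, map_sub, sub_eq_zero]
  have key := ih _ (by omega) ((B.orthogonal U) ⧸ U.comap (B.orthogonal U).subtype) B' p3
    (by
      intro z w
      obtain ⟨x, rfl⟩ := Submodule.mkQ_surjective _ z
      obtain ⟨y, rfl⟩ := Submodule.mkQ_surjective _ w
      simp only [Submodule.mkQ_apply]
      rw [p1, p1, hs]) h' N'
    (by
      intro z w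
      obtain ⟨x, rfl⟩ := Submodule.mkQ_surjective _ z
      obtain ⟨y, rfl⟩ := Submodule.mkQ_surjective _ w
      obtain ⟨hx, ex⟩ := p2 x
      obtain ⟨hy, ey⟩ := p2 y
      simp only [Submodule.mkQ_apply]
      rw [ex, ey, p1, p1, hh])
    (by
      intro z w
      obtain ⟨x, rfl⟩ := Submodule.mkQ_surjective _ z
      obtain ⟨y, rfl⟩ := Submodule.mkQ_surjective _ w
      simp only [Submodule.mkQ_apply]
      rw [hN', hN', p1, p1, hNQ, hNQ, hN])
    (by
      intro z
      obtain ⟨x, rfl⟩ := Submodule.mkQ_surjective _ z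
      obtain ⟨hx, ex⟩ := p2 x
      obtain ⟨hy, ey⟩ := p2 (NQ x)
      simp only [Submodule.mkQ_apply]
      rw [ex, hN', hN', ey, ← Submodule.Quotient.mk_neg, hmk]
      simp [hNQ, hhN])
    (by
      intro j hj z hz
      obtain ⟨x, rfl⟩ := Submodule.mkQ_surjective _ z
      obtain ⟨x1, hx1⟩ := hQ x x.2
      simp only [Submodule.mkQ_apply] at hz ⊢
      rw [hN'j, hN', ← Submodule.Quotient.mk_zero, hmk, hNQ, hNQj, ← hx1] at hz
      have e1 : N ((N ^ (j + 2)) x1) = 0 := by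
        have : (N ^ (j + 2)) x1 = N ((N ^ j) (N x1)) := by
          rw [pow_succ', Module.End.mul_apply, pow_succ, Module.End.mul_apply]
        rw [this]; simpa using hz
      obtain ⟨w, hw⟩ := hE (j + 2) (by simpa [parity_simps] using hj) x1 e1
      refine ⟨Submodule.Quotient.mk ⟨N w, hrange w⟩, ?_⟩
      rw [hN'j, hN'j, hmk, hNQj, hNQj, ← hx1]
      have a1 : N ((N ^ j) (N x1)) = (N ^ (j + 2)) x1 := by
        rw [pow_succ', Module.End.mul_apply, pow_succ, Module.End.mul_apply]
      have a2 : N ((N ^ (j + 1)) (N w)) = (N ^ (j + 2 + 1)) w := by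
        rw [pow_succ (n := j + 2), Module.End.mul_apply, pow_succ' (n := j + 1), Module.End.mul_apply]
      rw [a1, hw]; exact a2.symm) rfl
  have hev : ∃ t, finrank F U = 2 * t := ⟨m - r, by omega⟩
  obtain ⟨t, ht⟩ := hev
  have hk2 := key (m - 2 * t) (by omega)
  rw [p4, hk2, one_pow, one_mul]
  have : m = (m - 2 * t) + 2 * t := by omega
  conv_rhs => rw [this, pow_add, pow_mul]
  simp

open Polynomial in
lemma unis {F V : Type*} [Field F] [AddCommGroup V] [Module F V]
    (S : Module.End F V) (P : F[X]) (hP : Irreducible P) (k : ℕ) (hk : aeval S (P ^ k) = 0)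
    (p : F[X]) : ∃ j ≤ k, ∃ r s : F[X], aeval S (r * p) = aeval S (P ^ j) ∧
      aeval S p = aeval S (P ^ j * s) := by
  have key : ∀ k : ℕ, P ^ k ∣ p ∨ ∃ j < k, ∃ s, p = P ^ j * s ∧ ¬ P ∣ s := by
    intro k
    induction k with
    | zero => left; simp
    | succ k ih =>
      rcases ih with ⟨s, hs⟩ | ⟨j, hj, s, h1, h2⟩
      · by_cases hd : P ∣ s
        · left
          obtain ⟨t, rfl⟩ := hd
          exact ⟨t, by rw [hs]; ring⟩
        · right
          exact ⟨k, by omega, s, hs, hd⟩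
      · right
        exact ⟨j, by omega, s, h1, h2⟩
  rcases key k with ⟨s, hs⟩ | ⟨j, hj, s, h1, h2⟩
  · refine ⟨k, le_rfl, 0, s, ?_, by rw [hs]⟩
    rw [hk]; simp
  · have hco : IsCoprime (P ^ k) s := ((hP.coprime_iff_not_dvd).mpr h2).pow_left
    obtain ⟨a, b, hab⟩ := hco
    refine ⟨j, hj.le, b, s, ?_, by rw [h1]⟩
    have : b * p = P ^ j - (P ^ j * a) * P ^ k := by
      rw [h1]; linear_combination (P ^ j) * hab
    rw [this, map_sub, map_mul _ _ (P ^ k), hk]; simp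

open Polynomial in
/-- the cyclic submodule `F[S] v` -/
noncomputable def cyc {F V : Type*} [Field F] [AddCommGroup V] [Module F V]
    (S : Module.End F V) (v : V) : Submodule F V :=
  LinearMap.range ((LinearMap.applyₗ v) ∘ₗ (aeval S : F[X] →ₐ[F] Module.End F V).toLinearMap)

open Polynomial in
lemma mem_cyc {F V : Type*} [Field F] [AddCommGroup V] [Module F V]
    {S : Module.End F V} {v x : V} : x ∈ cyc S v ↔ ∃ q : F[X], aeval S q v = x := Iff.rfl

def IsSpl {F V : Type*} [Field F] [AddCommGroup V] [Module F V]
    (B : LinearMap.BilinForm F V) (S N : Module.End F V) (P M : Submodule F V) : Prop :=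
  P ⊔ M = ⊤ ∧ (∀ x ∈ P, ∀ y ∈ M, B x y = 0) ∧ (∀ x ∈ P, S x ∈ P) ∧ (∀ x ∈ M, S x ∈ M) ∧
    (∀ x ∈ P, N x ∈ M) ∧ (∀ x ∈ M, N x ∈ P)

structure SN {F V : Type*} [Field F] [AddCommGroup V] [Module F V]
    (B : LinearMap.BilinForm F V) (S N : Module.End F V) : Prop where
  h2 : (2 : F) ≠ 0
  nd : ∀ x, (∀ y, B x y = 0) → x = 0
  hs : ∀ x y, B x y = B y x
  sa : ∀ x y, B (S x) y = B x (S y)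
  sk : ∀ x y, B (N x) y = - B x (N y)
  cm : ∀ x, S (N x) = N (S x)
  sq : ∀ x, N (N x) = S (S x) - (4 : F) • x

namespace SN
open Polynomial
variable {F V : Type*} [Field F] [AddCommGroup V] [Module F V]
    {B : LinearMap.BilinForm F V} {S N : Module.End F V}

lemma psa (D : SN B S N) (q : F[X]) : ∀ x y, B (aeval S q x) y = B x (aeval S q y) := by
  induction q using Polynomial.induction_on' with
  | add p q hp hq => intro x y; simp [hp, hq]
  | monomial n a =>
    have : ∀ n : ℕ, ∀ x y, B ((S ^ n) x) y = B x ((S ^ n) y) := by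
      intro n
      induction n with
      | zero => intro x y; rfl
      | succ n ih =>
        intro x y
        rw [pow_succ, Module.End.mul_apply, ih, D.sa, ← Module.End.mul_apply, ← pow_succ', pow_succ]
    intro x y
    simp [aeval_monomial, this, Module.algebraMap_end_apply]

lemma pcm (D : SN B S N) (q : F[X]) (x : V) : aeval S q (N x) = N (aeval S q x) := by
  have h1 : Commute S N := LinearMap.ext D.cm
  have h2 : Commute (aeval S q) N := by
    induction q using Polynomial.induction_on' with
    | add p q hp hq => rw [map_add]; exact hp.add_left hq
    | monomial n a =>
      rw [aeval_monomial]
      have h3 : Commute (algebraMap F (Module.End F V) a) N := Algebra.commutes a N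
      exact h3.mul_left (h1.pow_left n)
  exact LinearMap.congr_fun h2 x

lemma pmul (q r : F[X]) (x : V) : aeval S q (aeval S r x) = aeval S (q * r) x := by
  rw [map_mul]; rfl

lemma psq (D : SN B S N) (x : V) : N (N x) = aeval S (X ^ 2 - C 4 : F[X]) x := by
  rw [D.sq]; simp [pow_two, Module.algebraMap_end_apply]

lemma sk0 (D : SN B S N) (q : F[X]) (x : V) : B x (aeval S q (N x)) = 0 := by
  have h1 : B x (aeval S q (N x)) = - B x (aeval S q (N x)) := by
    conv_lhs => rw [← D.psa, D.hs, D.sk, ← D.pcm]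
  have h3 : 2 * B x (aeval S q (N x)) = 0 := by linear_combination h1
  exact (mul_eq_zero.mp h3).resolve_left D.h2

lemma polar (D : SN B S N) (q : F[X]) (hq : aeval S q ≠ 0) : ∃ v, B v (aeval S q v) ≠ 0 := by
  by_contra hcon
  push Not at hcon
  apply hq
  ext x
  apply D.nd
  intro y
  have h1 := hcon (x + y)
  simp only [map_add, LinearMap.add_apply, hcon] at h1
  have h3 : B y (aeval S q x) = B x (aeval S q y) := by rw [D.hs, D.psa]
  have h4 : 2 * B (aeval S q x) y = 0 := by rw [D.psa]; linear_combination h1 - h3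
  exact (mul_eq_zero.mp h4).resolve_left D.h2

/-- orthogonal indecomposability -/
def Ind (B : LinearMap.BilinForm F V) (S N : Module.End F V) : Prop :=
  ∀ W : Submodule F V, (∀ x ∈ W, S x ∈ W) → (∀ x ∈ W, N x ∈ W) →
    (∀ x ∈ W, (∀ y ∈ W, B x y = 0) → x = 0) → W = ⊥ ∨ W = ⊤

lemma cyc_self (v : V) : v ∈ cyc S v := ⟨1, by simp⟩

lemma cyc_S {v x : V} (q : F[X]) (hx : x ∈ cyc S v) : aeval S q x ∈ cyc S v := by
  obtain ⟨r, rfl⟩ := mem_cyc.mp hx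
  exact mem_cyc.mpr ⟨q * r, by rw [pmul]⟩

lemma cyc_N (D : SN B S N) {v x : V} (hx : x ∈ cyc S v) : N x ∈ cyc S (N v) := by
  obtain ⟨r, rfl⟩ := mem_cyc.mp hx
  exact mem_cyc.mpr ⟨r, by rw [D.pcm]⟩

lemma cyc_NN (D : SN B S N) {v x : V} (hx : x ∈ cyc S (N v)) : N x ∈ cyc S v := by
  obtain ⟨r, rfl⟩ := mem_cyc.mp hx
  rw [← D.pcm, D.psq, pmul]
  exact mem_cyc.mpr ⟨_, rfl⟩

lemma struct (D : SN B S N) (I : Ind B S N) (u u' : V) (hu : u ≠ 0)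
    (huu : ∀ q : F[X], B (aeval S q u) u' = 0)
    (hP : ∀ x ∈ cyc S u ⊔ cyc S (N u'), (∀ y ∈ cyc S u ⊔ cyc S (N u'), B x y = 0) → x = 0)
    (hM : ∀ x ∈ cyc S u' ⊔ cyc S (N u), (∀ y ∈ cyc S u' ⊔ cyc S (N u), B x y = 0) → x = 0) :
    ∃ P M, IsSpl B S N P M := by
  set P := cyc S u ⊔ cyc S (N u') with hPd
  set M := cyc S u' ⊔ cyc S (N u) with hMd
  have orth : ∀ x ∈ P, ∀ y ∈ M, B x y = 0 := by
    intro x hx y hy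
    obtain ⟨x1, hx1, x2, hx2, rfl⟩ := Submodule.mem_sup.mp hx
    obtain ⟨y1, hy1, y2, hy2, rfl⟩ := Submodule.mem_sup.mp hy
    obtain ⟨a, rfl⟩ := mem_cyc.mp hx1
    obtain ⟨b, rfl⟩ := mem_cyc.mp hx2
    obtain ⟨c, rfl⟩ := mem_cyc.mp hy1
    obtain ⟨d, rfl⟩ := mem_cyc.mp hy2
    have e1 : B (aeval S a u) (aeval S c u') = 0 := by
      rw [← D.psa, pmul, huu]
    have e2 : B (aeval S a u) (aeval S d (N u)) = 0 := by
      rw [D.psa, pmul, D.sk0]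
    have e3 : B (aeval S b (N u')) (aeval S c u') = 0 := by
      rw [D.hs, D.psa, pmul, D.sk0]
    have e4 : B (aeval S b (N u')) (aeval S d (N u)) = 0 := by
      rw [D.psa, pmul, D.sk, ← D.pcm, D.psq, pmul, D.hs, huu, neg_zero]
    simp [e1, e2, e3, e4]
  have PS : ∀ x ∈ P, S x ∈ P := by
    intro x hx
    obtain ⟨x1, hx1, x2, hx2, rfl⟩ := Submodule.mem_sup.mp hx
    have h1 := cyc_S X hx1
    have h2 := cyc_S X hx2
    rw [aeval_X] at h1 h2
    rw [map_add]
    exact Submodule.add_mem_sup h1 h2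
  have MS : ∀ x ∈ M, S x ∈ M := by
    intro x hx
    obtain ⟨x1, hx1, x2, hx2, rfl⟩ := Submodule.mem_sup.mp hx
    have h1 := cyc_S X hx1
    have h2 := cyc_S X hx2
    rw [aeval_X] at h1 h2
    rw [map_add]
    exact Submodule.add_mem_sup h1 h2
  have PN : ∀ x ∈ P, N x ∈ M := by
    intro x hx
    obtain ⟨x1, hx1, x2, hx2, rfl⟩ := Submodule.mem_sup.mp hx
    rw [map_add, add_comm]
    exact Submodule.add_mem_sup (D.cyc_NN hx2) (D.cyc_N hx1)
  have MN : ∀ x ∈ M, N x ∈ P := by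
    intro x hx
    obtain ⟨x1, hx1, x2, hx2, rfl⟩ := Submodule.mem_sup.mp hx
    rw [map_add, add_comm]
    exact Submodule.add_mem_sup (D.cyc_NN hx2) (D.cyc_N hx1)
  refine ⟨P, M, ?_, orth, PS, MS, PN, MN⟩
  refine (I (P ⊔ M) ?_ ?_ ?_).resolve_left ?_
  · intro x hx
    obtain ⟨x1, hx1, x2, hx2, rfl⟩ := Submodule.mem_sup.mp hx
    rw [map_add]
    exact Submodule.add_mem_sup (PS _ hx1) (MS _ hx2)
  · intro x hx
    obtain ⟨x1, hx1, x2, hx2, rfl⟩ := Submodule.mem_sup.mp hx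
    rw [map_add, add_comm]
    exact Submodule.add_mem_sup (MN _ hx2) (PN _ hx1)
  · intro x hx hy
    obtain ⟨x1, hx1, x2, hx2, rfl⟩ := Submodule.mem_sup.mp hx
    have e1 : x1 = 0 := by
      apply hP x1 hx1
      intro y hyP
      have := hy y (Submodule.mem_sup_left hyP)
      rw [map_add, LinearMap.add_apply, D.hs x2, orth y hyP x2 hx2, add_zero] at this
      exact this
    have e2 : x2 = 0 := by
      apply hM x2 hx2
      intro y hyP
      have := hy y (Submodule.mem_sup_right hyP)
      rw [map_add, LinearMap.add_apply, orth x1 hx1 y hyP, zero_add] at this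
      exact this
    rw [e1, e2, add_zero]
  · intro h
    apply hu
    have : u ∈ P ⊔ M := Submodule.mem_sup_left (Submodule.mem_sup_left (cyc_self u))
    rw [h] at this
    exact (Submodule.mem_bot F).mp this

end SN

namespace SN
open Polynomial
variable {F V : Type*} [Field F] [AddCommGroup V] [Module F V]
    {B : LinearMap.BilinForm F V} {S N : Module.End F V}

lemma nd2 (D : SN B S N) (Q : F[X]) (hQ : Irreducible Q) (k : ℕ) (hk : aeval S (Q ^ (k + 1)) = 0)
    (hN : ∀ x, aeval S (Q ^ k) (N (N x)) = 0) (u u' : V)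
    (hB : B (aeval S (Q ^ k) (N u)) u' ≠ 0) :
    ∀ x ∈ cyc S u ⊔ cyc S (N u'), (∀ y ∈ cyc S u ⊔ cyc S (N u'), B x y = 0) → x = 0 := by
  intro x hx hy
  obtain ⟨x1, hx1, x2, hx2, rfl⟩ := Submodule.mem_sup.mp hx
  obtain ⟨a, rfl⟩ := mem_cyc.mp hx1
  obtain ⟨d, rfl⟩ := mem_cyc.mp hx2
  have hu := hy u (Submodule.mem_sup_left (cyc_self u))
  have hp1 : ∀ p : F[X], B (aeval S (p * a) u + aeval S (p * d) (N u')) u = 0 := by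
    intro p
    rw [← pmul, ← pmul, ← map_add, D.psa]
    exact hy _ (Submodule.mem_sup_left (cyc_S p (cyc_self u)))
  have hp2 : ∀ p : F[X], B (aeval S (p * a) u + aeval S (p * d) (N u')) (N u') = 0 := by
    intro p
    rw [← pmul, ← pmul, ← map_add, D.psa]
    exact hy _ (Submodule.mem_sup_right (cyc_S p (cyc_self _)))
  obtain ⟨ja, hja, ra, sa, ha1, ha2⟩ := unis S Q hQ _ hk a
  obtain ⟨jd, hjd, rd, sd, hd1, hd2⟩ := unis S Q hQ _ hk d
  rcases Nat.lt_or_ge jd ja with h | h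
  · exfalso
    have h1 := hp1 (Q ^ (k - jd) * rd)
    have e1 : aeval S (Q ^ (k - jd) * rd * d) = aeval S (Q ^ k) := by
      rw [mul_assoc, map_mul, hd1, ← map_mul, ← pow_add]; congr 2; omega
    have e2 : aeval S (Q ^ (k - jd) * rd * a) = 0 := by
      rw [map_mul, ha2, ← map_mul]
      have : Q ^ (k - jd) * rd * (Q ^ ja * sa) = (rd * sa * Q ^ (ja - jd - 1)) * Q ^ (k + 1) := by
        have : k + 1 = (k - jd) + (jd + 1) := by omega
        rw [this, pow_add]
        have : Q ^ ja = Q ^ (ja - jd - 1) * Q ^ (jd + 1) := by rw [← pow_add]; congr 1; omega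
        rw [this]; ring
      rw [this, map_mul, hk, mul_zero]
    rw [e1, e2, LinearMap.zero_apply, zero_add, D.psa, D.sk, ← D.pcm, D.hs] at h1
    exact hB (neg_eq_zero.mp h1)
  · rcases Nat.lt_or_ge k ja with h3 | h3
    · have e1 : aeval S a = 0 := by
        rw [ha2]
        have : Q ^ ja = Q ^ (k + 1) := by congr 1; omega
        rw [this, map_mul, hk, zero_mul]
      have e2 : aeval S d = 0 := by
        rw [hd2]
        have : Q ^ jd = Q ^ (k + 1) := by congr 1; omega
        rw [this, map_mul, hk, zero_mul]
      rw [e1, e2]; simp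
    · exfalso
      have h1 := hp2 (Q ^ (k - ja) * ra)
      have e1 : aeval S (Q ^ (k - ja) * ra * a) = aeval S (Q ^ k) := by
        rw [mul_assoc, map_mul, ha1, ← map_mul, ← pow_add]; congr 2; omega
      have e2 : aeval S (Q ^ (k - ja) * ra * d) = aeval S (Q ^ (jd - ja) * ra * sd * Q ^ k) := by
        rw [map_mul, hd2, ← map_mul]
        congr 1
        have : Q ^ jd = Q ^ (jd - ja) * Q ^ ja := by rw [← pow_add]; congr 1; omega
        have h4 : Q ^ k = Q ^ (k - ja) * Q ^ ja := by rw [← pow_add]; congr 1; omega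
        rw [this, h4]; ring
      rw [e1, e2, map_add, LinearMap.add_apply, D.hs _ (N u'), D.sk, D.hs _ (N u'), D.sk,
        ← D.pcm, ← D.pcm, ← pmul, hN, map_zero, map_zero, neg_zero, add_zero, D.hs] at h1
      exact hB (neg_eq_zero.mp h1)

lemma nd1 (D : SN B S N) (Q : F[X]) (hQ : Irreducible Q) (k : ℕ) (hk : aeval S (Q ^ (k + 1)) = 0)
    (v : V) (hB : B v (aeval S (Q ^ k) v) ≠ 0) :
    ∀ x ∈ cyc S v, (∀ y ∈ cyc S v, B x y = 0) → x = 0 := by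
  intro x hx hy
  obtain ⟨a, rfl⟩ := mem_cyc.mp hx
  obtain ⟨ja, hja, ra, sa, ha1, ha2⟩ := unis S Q hQ _ hk a
  rcases Nat.lt_or_ge k ja with h3 | h3
  · have e1 : aeval S a = 0 := by
      rw [ha2]
      have : Q ^ ja = Q ^ (k + 1) := by congr 1; omega
      rw [this, map_mul, hk, zero_mul]
    rw [e1]; simp
  · exfalso
    have h1 := hy _ (cyc_S (Q ^ (k - ja) * ra) (cyc_self v))
    have e1 : aeval S (Q ^ (k - ja) * ra * a) = aeval S (Q ^ k) := by
      rw [mul_assoc, map_mul, ha1, ← map_mul, ← pow_add]; congr 2; omega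
    rw [← D.psa, pmul, e1, D.hs] at h1
    exact hB h1

lemma cyc_zero : cyc S (0 : V) = ⊥ := by
  rw [eq_bot_iff]
  intro x hx
  obtain ⟨a, rfl⟩ := mem_cyc.mp hx
  simp

lemma single (D : SN B S N) (I : Ind B S N) (Q : F[X]) (hQ : Irreducible Q) (k : ℕ)
    (hk : aeval S (Q ^ (k + 1)) = 0)
    (v : V) (hB : B v (aeval S (Q ^ k) v) ≠ 0)
    (H : ∀ b : F[X], N (aeval S b (N v)) = 0 → aeval S b (N v) = 0) :
    ∃ P M, IsSpl B S N P M := by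
  have h1 := D.nd1 Q hQ k hk v hB
  apply D.struct I v 0
  · rintro rfl; simp at hB
  · simp
  · simpa [cyc_zero] using h1
  · rw [cyc_zero, bot_sup_eq]
    intro x hx hy
    obtain ⟨b, rfl⟩ := mem_cyc.mp hx
    apply H
    rw [← D.pcm, D.psq, pmul]
    apply h1 _ (cyc_S _ (cyc_self v))
    intro y hyc
    rw [← pmul, ← D.psq, D.pcm, D.sk, hy _ (D.cyc_N hyc), neg_zero]

lemma fit [FiniteDimensional F V] (D : SN B S N) (I : Ind B S N) (q : F[X]) :
    (∃ n, aeval S (q ^ n) = 0) ∨ ∀ x, aeval S q x = 0 → x = 0 := by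
  obtain ⟨n, hn, hn1⟩ := ((LinearMap.eventually_isCompl_ker_pow_range_pow (aeval S q)).and
    (Filter.eventually_ge_atTop 1)).exists
  rw [← map_pow] at hn
  suffices hI : LinearMap.ker (aeval S (q ^ n)) = ⊥ ∨ LinearMap.ker (aeval S (q ^ n)) = ⊤ by
    rcases hI with h | h
    · right
      intro x hx
      have : x ∈ LinearMap.ker (aeval S (q ^ n)) := by
        rw [LinearMap.mem_ker]
        obtain ⟨m, rfl⟩ : ∃ m, n = m + 1 := ⟨n - 1, by omega⟩
        rw [pow_succ, ← pmul, hx, map_zero]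
      rw [h] at this
      exact (Submodule.mem_bot F).mp this
    · left
      exact ⟨n, LinearMap.ker_eq_top.mp h⟩
  refine I _ ?_ ?_ ?_
  · intro x hx
    rw [LinearMap.mem_ker] at hx ⊢
    have : S x = aeval S (X : F[X]) x := by simp
    rw [this, pmul, mul_comm, ← pmul, hx, map_zero]
  · intro x hx
    rw [LinearMap.mem_ker] at hx ⊢
    rw [D.pcm, hx, map_zero]
  · intro x hx hy
    apply D.nd
    intro y
    have : y ∈ LinearMap.ker (aeval S (q ^ n)) ⊔ LinearMap.range (aeval S (q ^ n)) := by
      rw [hn.sup_eq_top]; trivial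
    obtain ⟨y1, hy1, y2, ⟨z, rfl⟩, rfl⟩ := Submodule.mem_sup.mp this
    rw [map_add, hy y1 hy1, ← D.psa, LinearMap.mem_ker.mp hx]
    simp

lemma ind_spl [FiniteDimensional F V] [Nontrivial V] (D : SN B S N) (I : Ind B S N) :
    ∃ P M, IsSpl B S N P M := by
  have minim : ∀ Q : F[X], (∃ n, aeval S (Q ^ n) = 0) →
      ∃ k, aeval S (Q ^ (k + 1)) = 0 ∧ aeval S (Q ^ k) ≠ 0 := by
    intro Q h
    classical
    have h1 := Nat.find_spec h
    have h3 : Nat.find h ≠ 0 := by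
      intro h0
      rw [h0] at h1
      simp at h1
    obtain ⟨k, hk⟩ := Nat.exists_eq_succ_of_ne_zero h3
    refine ⟨k, ?_, ?_⟩
    · rw [hk] at h1; exact h1
    · exact Nat.find_min h (by omega)
  by_cases hNi : ∀ x, N x = 0 → x = 0
  · have hint := Algebra.IsIntegral.isIntegral (R := F) S
    obtain ⟨Q, hQ, hQd⟩ := WfDvdMonoid.exists_irreducible_factor (minpoly.not_isUnit F S)
      (minpoly.ne_zero hint)
    have hQn : ∃ n, aeval S (Q ^ n) = 0 := by
      apply (D.fit I Q).resolve_right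
      intro hinj
      obtain ⟨s, hs⟩ := hQd
      have h0 : aeval S s = 0 := by
        ext x
        apply hinj
        rw [pmul, ← hs, minpoly.aeval]; simp
      have hs0 : s ≠ 0 := by
        rintro rfl
        rw [mul_zero] at hs
        exact minpoly.ne_zero hint hs
      have := natDegree_le_of_dvd (minpoly.dvd F S h0) hs0
      rw [hs, natDegree_mul hQ.ne_zero hs0] at this
      have := hQ.natDegree_pos
      omega
    obtain ⟨k, hk, hk'⟩ := minim Q hQn
    obtain ⟨v, hv⟩ := D.polar _ hk'
    exact D.single I Q hQ k hk v hv (fun b hb => hNi _ hb)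
  · have hfac : ∀ e : F, e * e = 4 → ∀ x, N (N x) = aeval S (X + C e) (aeval S (X - C e) x) := by
      intro e he x
      rw [D.psq, pmul]
      congr 2
      have : (C 4 : F[X]) = C e * C e := by rw [← C_mul, he]
      rw [this]; ring
    obtain ⟨e, he, he2⟩ : ∃ e : F, e * e = 4 ∧ ¬ ∀ x, aeval S (X - C e) x = 0 → x = 0 := by
      by_contra hcon
      push Not at hcon
      apply hNi
      intro x hx
      have h1 := hfac 2 (by norm_num) x
      rw [hx, map_zero] at h1
      apply hcon 2 (by norm_num)
      apply hcon (-2) (by norm_num)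
      rw [h1]; simp
    have he0 : e ≠ 0 := by
      rintro rfl
      have : (4 : F) = 2 * 2 := by norm_num
      rw [this, zero_mul] at he
      exact D.h2 (by simpa using he.symm)
    have hnil := (D.fit I (X - C e)).resolve_right he2
    have hinj : ∀ x, aeval S (X + C e) x = 0 → x = 0 := by
      refine (D.fit I (X + C e)).resolve_left ?_
      rintro ⟨m, hm⟩
      obtain ⟨n, hn⟩ := hnil
      have hco : IsCoprime (X - C e) (X + C e) := by
        refine ⟨- C ((2 * e)⁻¹), C ((2 * e)⁻¹), ?_⟩
        have : C ((2 * e)⁻¹) * (C 2 * C e) = (1 : F[X]) := by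
          rw [← C_mul, ← C_mul, inv_mul_cancel₀ (mul_ne_zero D.h2 he0), C_1]
        have h2 : (C 2 : F[X]) = 2 := rfl
        rw [h2] at this
        linear_combination this
      obtain ⟨a, b, hab⟩ := hco.pow (m := n) (n := m)
      have h1 : aeval S (1 : F[X]) = 0 := by
        rw [← hab, map_add, map_mul, map_mul, hn, hm]; simp
      simp at h1
    obtain ⟨k, hk, hk'⟩ := minim _ hnil
    have hQ : Irreducible (X - C e) := irreducible_X_sub_C e
    have hN : ∀ x, aeval S ((X - C e) ^ k) (N (N x)) = 0 := by
      intro x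
      rw [hfac e he, pmul, pmul, mul_assoc, mul_comm (X + C e), ← mul_assoc, ← pow_succ, mul_comm,
        ← pmul, hk]
      simp
    by_cases hII : ∀ x, aeval S ((X - C e) ^ k) (N x) = 0
    · obtain ⟨v, hv⟩ := D.polar _ hk'
      refine D.single I _ hQ k hk v hv ?_
      intro b hb
      have hb2 : aeval S (b * (X - C e)) v = 0 := by
        apply hinj
        rw [← D.pcm, hfac e he, pmul, pmul] at hb
        rw [pmul, ← hb]
        congr 2; ring
      obtain ⟨j, hj, r, s, h1, h2⟩ := unis S _ hQ _ hk b
      rcases Nat.lt_or_ge j k with h3 | h3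
      · exfalso
        have h4 : aeval S ((X - C e) ^ k) v = 0 := by
          have h5 : aeval S ((X - C e) ^ (k - j - 1) * r * (b * (X - C e))) v = 0 := by
            rw [← pmul, hb2, map_zero]
          have h6 : aeval S ((X - C e) ^ (k - j - 1) * r * (b * (X - C e))) =
              aeval S ((X - C e) ^ k) := by
            have h7 : (X - C e) ^ (k - j - 1) * r * (b * (X - C e)) =
              ((X - C e) ^ (k - j - 1) * (X - C e)) * (r * b) := by ring
            rw [h7, map_mul, h1, ← map_mul, ← pow_succ, ← pow_add]
            congr 2; omega
          rw [← h6, h5]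
        rw [h4, map_zero] at hv
        exact hv rfl
      · rw [h2]
        have h7 : (X - C e) ^ j * s = ((X - C e) ^ (j - k) * s) * (X - C e) ^ k := by
          have : (X - C e) ^ j = (X - C e) ^ (j - k) * (X - C e) ^ k := by
            rw [← pow_add]; congr 1; omega
          rw [this]; ring
        rw [h7, ← pmul, hII, map_zero]
    · push Not at hII
      obtain ⟨u, hu⟩ := hII
      have hnot : aeval S ((X - C e) ^ k) (N u) ∉ cyc S u := by
        intro hmem
        obtain ⟨a, ha⟩ := mem_cyc.mp hmem
        obtain ⟨j, hj, r, s, h1, h2⟩ := unis S _ hQ _ hk a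
        rcases Nat.lt_or_ge k j with h3 | h3
        · have h4 : aeval S a = 0 := by
            have h5 : j = k + 1 := by omega
            rw [h2, h5, map_mul, hk, zero_mul]
          rw [h4] at ha
          exact hu (by rw [← ha]; rfl)
        · apply hu
          have h4 : aeval S ((X - C e) ^ (k - j) * r * a) = aeval S ((X - C e) ^ k) := by
            rw [mul_assoc, map_mul, h1, ← map_mul, ← pow_add]; congr 2; omega
          rw [D.pcm, ← h4, ← pmul, ha, ← D.pcm, ← D.pcm, hN, map_zero]
      have hrefl : B.IsRefl := fun x y hxy => by rw [D.hs, hxy]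
      have hnd : B.Nondegenerate := ⟨D.nd, fun y hy => D.nd y fun x => by rw [D.hs, hy]⟩
      have hoo := LinearMap.BilinForm.orthogonal_orthogonal hnd hrefl (cyc S u)
      rw [← hoo, LinearMap.BilinForm.mem_orthogonal_iff] at hnot
      push Not at hnot
      obtain ⟨u', hu', hB⟩ := hnot
      rw [LinearMap.BilinForm.mem_orthogonal_iff] at hu'
      have hB1 : B u' (aeval S ((X - C e) ^ k) (N u)) ≠ 0 := hB
      have hB2 : B (aeval S ((X - C e) ^ k) (N u)) u' ≠ 0 := by rw [D.hs]; exact hB1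
      have hB3 : B (aeval S ((X - C e) ^ k) (N u')) u ≠ 0 := by
        rw [D.psa, D.sk, ← D.pcm]
        exact neg_ne_zero.mpr hB1
      refine D.struct I u u' ?_ ?_ ?_ ?_
      · rintro rfl; simp at hu
      · intro q
        exact hu' _ (cyc_S q (cyc_self u))
      · exact D.nd2 _ hQ k hk hN u u' hB2
      · exact D.nd2 _ hQ k hk hN u' u hB3

end SN

lemma IsSpl.swap {F V : Type*} [Field F] [AddCommGroup V] [Module F V]
    {B : LinearMap.BilinForm F V} {S N : Module.End F V} {P M : Submodule F V}
    (hs : ∀ x y, B x y = B y x) (h : IsSpl B S N P M) : IsSpl B S N M P :=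
  ⟨by rw [sup_comm]; exact h.1, fun x hx y hy => by rw [hs]; exact h.2.1 y hy x hx,
    h.2.2.2.1, h.2.2.1, h.2.2.2.2.2, h.2.2.2.2.1⟩

namespace SN
variable {F V : Type*} [Field F] [AddCommGroup V] [Module F V]
    {B : LinearMap.BilinForm F V} {S N : Module.End F V}

lemma restr (D : SN B S N) (W : Submodule F V) (hS : ∀ x ∈ W, S x ∈ W) (hN : ∀ x ∈ W, N x ∈ W)
    (hW : ∀ x ∈ W, (∀ y ∈ W, B x y = 0) → x = 0) :
    SN (B.restrict W) (S.restrict hS) (N.restrict hN) where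
  h2 := D.h2
  nd := fun x hx => Subtype.ext (hW x x.2 fun y hy => hx ⟨y, hy⟩)
  hs := fun x y => D.hs x y
  sa := fun x y => D.sa x y
  sk := fun x y => D.sk x y
  cm := fun x => Subtype.ext (D.cm x)
  sq := fun x => Subtype.ext (D.sq x)

lemma orthS (D : SN B S N) (W : Submodule F V) (hS : ∀ x ∈ W, S x ∈ W) :
    ∀ x ∈ B.orthogonal W, S x ∈ B.orthogonal W := by
  intro x hx
  rw [LinearMap.BilinForm.mem_orthogonal_iff] at hx ⊢
  intro w hw
  have := hx (S w) (hS w hw)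
  change B (S w) x = 0 at this
  change B w (S x) = 0
  rw [← D.sa, this]

lemma orthN (D : SN B S N) (W : Submodule F V) (hN : ∀ x ∈ W, N x ∈ W) :
    ∀ x ∈ B.orthogonal W, N x ∈ B.orthogonal W := by
  intro x hx
  rw [LinearMap.BilinForm.mem_orthogonal_iff] at hx ⊢
  intro w hw
  have := hx (N w) (hN w hw)
  change B (N w) x = 0 at this
  change B w (N x) = 0
  rw [D.sk] at this
  exact neg_eq_zero.mp this

lemma compl [FiniteDimensional F V] (D : SN B S N) (W : Submodule F V)
    (hW : ∀ x ∈ W, (∀ y ∈ W, B x y = 0) → x = 0) : IsCompl W (B.orthogonal W) := by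
  apply LinearMap.BilinForm.isCompl_orthogonal_of_restrict_nondegenerate
  · exact fun x y hxy => by rw [D.hs, hxy]
  · refine ⟨fun x hx => Subtype.ext (hW x x.2 fun y hy => hx ⟨y, hy⟩),
      fun x hx => Subtype.ext (hW x x.2 fun y hy => ?_)⟩
    rw [D.hs]; exact hx ⟨y, hy⟩

lemma orthnd [FiniteDimensional F V] (D : SN B S N) (W : Submodule F V)
    (hW : ∀ x ∈ W, (∀ y ∈ W, B x y = 0) → x = 0) :
    ∀ x ∈ B.orthogonal W, (∀ y ∈ B.orthogonal W, B x y = 0) → x = 0 := by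
  intro x hx hy
  apply D.nd
  intro y
  have : y ∈ W ⊔ B.orthogonal W := by rw [(D.compl W hW).sup_eq_top]; trivial
  obtain ⟨y1, hy1, y2, hy2, rfl⟩ := Submodule.mem_sup.mp this
  rw [LinearMap.BilinForm.mem_orthogonal_iff] at hx
  have h1 : B y1 x = 0 := hx y1 hy1
  rw [map_add, hy y2 hy2, D.hs, h1, add_zero]

lemma glue [FiniteDimensional F V] (D : SN B S N) (W W' : Submodule F V) (hc : W ⊔ W' = ⊤)
    (ho : ∀ x ∈ W, ∀ y ∈ W', B x y = 0)
    (hS : ∀ x ∈ W, S x ∈ W) (hN : ∀ x ∈ W, N x ∈ W)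
    (hS' : ∀ x ∈ W', S x ∈ W') (hN' : ∀ x ∈ W', N x ∈ W')
    (P M : Submodule F W) (P' M' : Submodule F W')
    (h : IsSpl (B.restrict W) (S.restrict hS) (N.restrict hN) P M)
    (h' : IsSpl (B.restrict W') (S.restrict hS') (N.restrict hN') P' M') :
    IsSpl B S N (P.map W.subtype ⊔ P'.map W'.subtype) (M.map W.subtype ⊔ M'.map W'.subtype) := by
  have stab : ∀ (T : Module.End F V) (hT : ∀ x ∈ W, T x ∈ W) (hT' : ∀ x ∈ W', T x ∈ W')
      (A C : Submodule F W) (A' C' : Submodule F W')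
      (_ : ∀ x ∈ A, T.restrict hT x ∈ C) (_ : ∀ x ∈ A', T.restrict hT' x ∈ C'),
      ∀ x ∈ A.map W.subtype ⊔ A'.map W'.subtype, T x ∈ C.map W.subtype ⊔ C'.map W'.subtype := by
    intro T hT hT' A C A' C' h1 h2 x hx
    obtain ⟨x1, ⟨a, ha, rfl⟩, x2, ⟨b, hb, rfl⟩, rfl⟩ := Submodule.mem_sup.mp hx
    rw [map_add]
    exact Submodule.add_mem_sup ⟨_, h1 a ha, rfl⟩ ⟨_, h2 b hb, rfl⟩
  obtain ⟨a1, a2, a3, a4, a5, a6⟩ := h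
  obtain ⟨b1, b2, b3, b4, b5, b6⟩ := h'
  refine ⟨?_, ?_, stab _ _ _ _ _ _ _ a3 b3, stab _ _ _ _ _ _ _ a4 b4, stab _ _ _ _ _ _ _ a5 b5,
    stab _ _ _ _ _ _ _ a6 b6⟩
  · rw [sup_sup_sup_comm, ← Submodule.map_sup, ← Submodule.map_sup, a1, b1]
    simpa using hc
  · intro x hx y hy
    obtain ⟨x1, ⟨a, ha, rfl⟩, x2, ⟨b, hb, rfl⟩, rfl⟩ := Submodule.mem_sup.mp hx
    obtain ⟨y1, ⟨c, hc, rfl⟩, y2, ⟨d, hd, rfl⟩, rfl⟩ := Submodule.mem_sup.mp hy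
    have e1 : B (a : V) (c : V) = 0 := a2 a ha c hc
    have e2 : B (b : V) (d : V) = 0 := b2 b hb d hd
    have e3 : B (a : V) (d : V) = 0 := ho _ a.2 _ d.2
    have e4 : B (b : V) (c : V) = 0 := by rw [D.hs]; exact ho _ c.2 _ b.2
    simp [e1, e2, e3, e4]

end SN

lemma wonen {F : Type*} [Field F] : ∀ (d : ℕ) (V : Type*) [AddCommGroup V] [Module F V]
    [FiniteDimensional F V] (B : LinearMap.BilinForm F V) (S N : Module.End F V),
    SN B S N → finrank F V = d → ∃ P M, IsSpl B S N P M := by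
  intro d
  induction d using Nat.strong_induction_on with
  | _ d ih =>
  intro V _ _ _ B S N D hd
  rcases subsingleton_or_nontrivial V with hV | hV
  · refine ⟨⊤, ⊤, by simp, fun x _ y _ => ?_, by simp, by simp, by simp, by simp⟩
    rw [Subsingleton.elim x 0]; simp
  by_cases I : SN.Ind B S N
  · exact D.ind_spl I
  · unfold SN.Ind at I
    push Not at I
    obtain ⟨W, hS, hN, hW, hb, ht⟩ := I
    have hc := D.compl W hW
    have hlt : finrank F W < d := by rw [← hd]; exact Submodule.finrank_lt ht
    have hlt' : finrank F (B.orthogonal W) < d := by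
      have h1 := Submodule.finrank_add_eq_of_isCompl hc
      have h2 := Nat.pos_of_ne_zero (mt Submodule.finrank_eq_zero.mp hb)
      omega
    obtain ⟨P, M, h⟩ := ih _ hlt W _ _ _ (D.restr W hS hN hW) rfl
    obtain ⟨P', M', h'⟩ := ih _ hlt' (B.orthogonal W) _ _ _ (D.restr _ (D.orthS W hS) (D.orthN W hN)
      (D.orthnd W hW)) rfl
    exact ⟨_, _, D.glue W _ hc.sup_eq_top (fun x hx y hy => by
      rw [LinearMap.BilinForm.mem_orthogonal_iff] at hy
      exact hy x hx) _ _ _ _ _ _ _ _ h h'⟩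

lemma SN.inf_bot {F V : Type*} [Field F] [AddCommGroup V] [Module F V]
    {B : LinearMap.BilinForm F V} {S N : Module.End F V} {P M : Submodule F V}
    (D : SN B S N) (h : IsSpl B S N P M) : IsCompl P M := by
  refine ⟨?_, codisjoint_iff.mpr h.1⟩
  rw [Submodule.disjoint_def]
  intro x hx hy
  apply D.nd
  intro y
  have : y ∈ P ⊔ M := by rw [h.1]; trivial
  obtain ⟨y1, hy1, y2, hy2, rfl⟩ := Submodule.mem_sup.mp this
  rw [map_add, h.2.1 x hx y2 hy2, D.hs, h.2.1 y1 hy1 x hy, add_zero]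

/-- splitting with the minus part of even dimension -/
lemma evenM {F V : Type*} [Field F] [AddCommGroup V] [Module F V] [FiniteDimensional F V]
    {B : LinearMap.BilinForm F V} {S N : Module.End F V} (D : SN B S N)
    (W : Submodule F V) (hS : ∀ x ∈ W, S x ∈ W) (hN : ∀ x ∈ W, N x ∈ W)
    (hW : ∀ x ∈ W, (∀ y ∈ W, B x y = 0) → x = 0) (hodd : Odd (finrank F W)) :
    ∃ P M, IsSpl B S N P M ∧ Even (finrank F M) := by
  have hc := D.compl W hW
  have D1 := D.restr W hS hN hW
  have D2 := D.restr _ (D.orthS W hS) (D.orthN W hN) (D.orthnd W hW)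
  obtain ⟨P, M, h⟩ := wonen _ _ _ _ _ D1 rfl
  obtain ⟨P', M', h'⟩ := wonen _ _ _ _ _ D2 rfl
  have ho : ∀ x ∈ W, ∀ y ∈ B.orthogonal W, B x y = 0 := fun x hx y hy => by
      rw [LinearMap.BilinForm.mem_orthogonal_iff] at hy
      exact hy x hx
  have g1 := D.glue W _ hc.sup_eq_top ho _ _ _ _ _ _ _ _ h h'
  have g2 := D.glue W _ hc.sup_eq_top ho _ _ _ _ _ _ _ _ (h.swap D1.hs) h'
  have hsum := Submodule.finrank_add_eq_of_isCompl (D1.inf_bot h)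
  have dimM : ∀ A : Submodule F W, finrank F ↥(A.map W.subtype ⊔ M'.map (B.orthogonal W).subtype)
      = finrank F A + finrank F M' := by
    intro A
    have h1 := Submodule.finrank_sup_add_finrank_inf_eq (A.map W.subtype)
      (M'.map (B.orthogonal W).subtype)
    have h2 : A.map W.subtype ⊓ M'.map (B.orthogonal W).subtype = ⊥ := by
      rw [eq_bot_iff, ← hc.inf_eq_bot]
      apply inf_le_inf
      · rintro _ ⟨a, _, rfl⟩; exact a.2
      · rintro _ ⟨a, _, rfl⟩; exact a.2
    rw [h2, finrank_bot, add_zero, Submodule.finrank_map_subtype_eq,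
      Submodule.finrank_map_subtype_eq] at h1
    exact h1
  rcases Nat.even_or_odd (finrank F M + finrank F M') with he | he
  · exact ⟨_, _, g1, by rw [dimM]; exact he⟩
  · refine ⟨_, _, g2, ?_⟩
    rw [dimM]
    grind

lemma invol {F V : Type*} [Field F] [AddCommGroup V] [Module F V] [FiniteDimensional F V]
    {B : LinearMap.BilinForm F V} {S N : Module.End F V} (D : SN B S N)
    (P M : Submodule F V) (h : IsSpl B S N P M) (he : Even (finrank F M)) :
    ∃ σ : Module.End F V, (∀ x y, B (σ x) (σ y) = B x y) ∧ LinearMap.det σ = 1 ∧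
      (∀ x, σ (σ x) = x) ∧ (∀ x, σ (S x) = S (σ x)) ∧ (∀ x, σ (N x) = - N (σ x)) := by
  have hc := D.inf_bot h
  obtain ⟨a1, a2, a3, a4, a5, a6⟩ := h
  let σ : Module.End F V := LinearMap.ofIsCompl hc P.subtype (-M.subtype)
  have sP : ∀ x ∈ P, σ x = x := fun x hx => LinearMap.ofIsCompl_apply_left hc ⟨x, hx⟩
  have sM : ∀ x ∈ M, σ x = - x := fun x hx => LinearMap.ofIsCompl_apply_right hc ⟨x, hx⟩
  have dec : ∀ y, ∃ u ∈ P, ∃ v ∈ M, u + v = y := by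
    intro y
    have : y ∈ P ⊔ M := by rw [a1]; trivial
    exact Submodule.mem_sup.mp this
  refine ⟨σ, ?_, ?_, ?_, ?_, ?_⟩
  · intro x y
    obtain ⟨x1, h1, x2, h2, rfl⟩ := dec x
    obtain ⟨y1, h3, y2, h4, rfl⟩ := dec y
    have e1 := a2 _ h1 _ h4
    have e2 : B x2 y1 = 0 := by rw [D.hs]; exact a2 _ h3 _ h2
    simp [sP _ h1, sP _ h3, sM _ h2, sM _ h4, e1, e2]
  · have hk : M ≤ M.comap σ := by
      intro x hx
      rw [Submodule.mem_comap, sM x hx]; exact neg_mem hx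
    rw [LinearMap.det_eq_det_mul_det M σ hk]
    have e1 : σ.restrict hk = (-1 : F) • LinearMap.id := by
      ext x
      simp [sM x x.2]
    have e2 : M.mapQ M σ hk = LinearMap.id := by
      apply Submodule.linearMap_qext
      ext x
      obtain ⟨x1, h1, x2, h2, rfl⟩ := dec x
      simp only [LinearMap.comp_apply, Submodule.mkQ_apply, Submodule.mapQ_apply, LinearMap.id_apply]
      rw [Submodule.Quotient.eq, map_add, sP _ h1, sM _ h2]
      have : x1 + -x2 - (x1 + x2) = (-2 : F) • x2 := by module
      rw [this]
      exact M.smul_mem _ h2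
    rw [e1, e2, LinearMap.det_smul, LinearMap.det_id, LinearMap.det_id, he.neg_one_pow]
    simp
  · intro x
    obtain ⟨x1, h1, x2, h2, rfl⟩ := dec x
    simp [sP _ h1, sM _ h2]
  · intro x
    obtain ⟨x1, h1, x2, h2, rfl⟩ := dec x
    simp [sP _ h1, sM _ h2, sP _ (a3 _ h1), sM _ (a4 _ h2)]
  · intro x
    obtain ⟨x1, h1, x2, h2, rfl⟩ := dec x
    simp [sP _ h1, sM _ h2, sM _ (a5 _ h1), sP _ (a6 _ h2)]
    abel

lemma rk1 {F V : Type*} [Field F] [AddCommGroup V] [Module F V] [FiniteDimensional F V]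
    (ν : Module.End F V) (j : ℕ) : finrank F (LinearMap.range (ν ^ j)) =
      finrank F (LinearMap.range (ν ^ (j + 1))) +
        finrank F ↥(LinearMap.range (ν ^ j) ⊓ LinearMap.ker ν) := by
  have h1 := LinearMap.finrank_range_add_finrank_ker (ν.domRestrict (LinearMap.range (ν ^ j)))
  have h2 : LinearMap.range (ν.domRestrict (LinearMap.range (ν ^ j))) =
      LinearMap.range (ν ^ (j + 1)) := by
    ext y
    constructor
    · rintro ⟨⟨_, z, rfl⟩, rfl⟩
      exact ⟨z, by rw [pow_succ']; rfl⟩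
    · rintro ⟨z, rfl⟩
      exact ⟨⟨_, z, rfl⟩, by rw [pow_succ']; rfl⟩
  have h3 : (LinearMap.ker (ν.domRestrict (LinearMap.range (ν ^ j)))).map
      (LinearMap.range (ν ^ j)).subtype = LinearMap.range (ν ^ j) ⊓ LinearMap.ker ν := by
    ext y
    constructor
    · rintro ⟨⟨y, hy⟩, hk, rfl⟩
      exact ⟨hy, hk⟩
    · rintro ⟨hy, hk⟩
      exact ⟨⟨y, hy⟩, hk, rfl⟩
  rw [h2] at h1
  rw [← h3, Submodule.finrank_map_subtype_eq, h1]

lemma rk2 {F V : Type*} [Field F] [AddCommGroup V] [Module F V] [FiniteDimensional F V]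
    (ν : Module.End F V) (j : ℕ) :
    finrank F (LinearMap.range (ν ^ j)) + finrank F (LinearMap.range (ν ^ (j + 1 + 1))) =
      2 * finrank F (LinearMap.range (ν ^ (j + 1))) ↔
    ∀ z, ν ((ν ^ j) z) = 0 → ∃ w, (ν ^ j) z = (ν ^ (j + 1)) w := by
  have h1 := rk1 ν j
  have h2 := rk1 ν (j + 1)
  have hle : LinearMap.range (ν ^ (j + 1)) ⊓ LinearMap.ker ν ≤
      LinearMap.range (ν ^ j) ⊓ LinearMap.ker ν := by
    apply inf_le_inf_right
    rintro _ ⟨w, rfl⟩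
    exact ⟨ν w, by rw [pow_succ]; rfl⟩
  constructor
  · intro h z hz
    have := Submodule.eq_of_le_of_finrank_eq hle (by omega)
    have hm : (ν ^ j) z ∈ LinearMap.range (ν ^ j) ⊓ LinearMap.ker ν := ⟨⟨z, rfl⟩, hz⟩
    rw [← this] at hm
    obtain ⟨w, hw⟩ := hm.1
    exact ⟨w, hw.symm⟩
  · intro h
    have : LinearMap.range (ν ^ (j + 1)) ⊓ LinearMap.ker ν =
      LinearMap.range (ν ^ j) ⊓ LinearMap.ker ν := by
      apply le_antisymm hle
      rintro _ ⟨⟨z, rfl⟩, hk⟩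
      obtain ⟨w, hw⟩ := h z hk
      exact ⟨⟨w, hw.symm⟩, hk⟩
    rw [this] at h2
    omega

/-- an isometry with its inverse -/
structure GI {F V : Type*} [Field F] [AddCommGroup V] [Module F V]
    (B : LinearMap.BilinForm F V) (g g' : Module.End F V) : Prop where
  h2 : (2 : F) ≠ 0
  nd : ∀ x, (∀ y, B x y = 0) → x = 0
  hs : ∀ x y, B x y = B y x
  iso : ∀ x y, B (g x) (g y) = B x y
  gg : g * g' = 1
  gg' : g' * g = 1

namespace GI
open Polynomial
variable {F V : Type*} [Field F] [AddCommGroup V] [Module F V]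
    {B : LinearMap.BilinForm F V} {g g' : Module.End F V}

lemma ap (G : GI B g g') (x : V) : g (g' x) = x := LinearMap.congr_fun G.gg x
lemma ap' (G : GI B g g') (x : V) : g' (g x) = x := LinearMap.congr_fun G.gg' x

lemma adj (G : GI B g g') (x y : V) : B (g x) y = B x (g' y) := by
  conv_lhs => rw [← G.ap y, G.iso]

lemma adj' (G : GI B g g') (x y : V) : B (g' x) y = B x (g y) := by
  rw [G.hs, ← G.adj, G.hs]

lemma toSN (G : GI B g g') : SN B (g + g') (g - g') where
  h2 := G.h2
  nd := G.nd
  hs := G.hs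
  sa := fun x y => by simp [G.adj, G.adj', add_comm]
  sk := fun x y => by simp [G.adj, G.adj']
  cm := fun x => by
    simp only [LinearMap.sub_apply, LinearMap.add_apply, map_sub, map_add, G.ap, G.ap']
    abel
  sq := fun x => by
    simp only [LinearMap.sub_apply, LinearMap.add_apply, map_sub, map_add, G.ap, G.ap']
    module

lemma detm (G : GI B g g') [FiniteDimensional F V] (h : Module.End F V)
    (hi : ∀ x y, B (h x) (h y) = B x y) (hg : ∀ x, h (g x) = g' (h x))
    (H : ∀ ε : F, (ε = 1 ∨ ε = -1) → ∀ j, Even j → ∀ z, (g - ε • (1 : Module.End F V)) (((g - ε • (1 : Module.End F V)) ^ j) z) = 0 →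
      ∃ w, ((g - ε • (1 : Module.End F V)) ^ j) z = ((g - ε • (1 : Module.End F V)) ^ (j + 1)) w)
    (m : ℕ) (hm : finrank F V = 2 * m) : LinearMap.det h = (-1) ^ m := by
  have D := G.toSN
  refine detB G.h2 _ V B G.nd G.hs h (g - g') hi D.sk ?_ ?_ rfl m hm
  · intro x
    have h1 : h (g' x) = g (h x) := by
      have := hg (g' x)
      rw [G.ap] at this
      rw [this, G.ap]
    simp [hg, h1]
  · intro j hj z hz
    have cgg : Commute g g' := by rw [Commute, SemiconjBy, G.gg, G.gg']
    have half : ∀ ε : F, (ε = 1 ∨ ε = -1) →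
        ∃ w, ((g - g') ^ j) z + ε • g (((g - g') ^ j) z) = ((g - g') ^ (j + 1)) w := by
      intro ε hε
      have hee : ε * ε = 1 := by rcases hε with rfl | rfl <;> ring
      have hN : g - g' = (g' * (g + ε • (1 : Module.End F V))) * (g - ε • (1 : Module.End F V)) := by
        ext x
        simp only [LinearMap.sub_apply, Module.End.mul_apply, LinearMap.add_apply, map_sub, map_add,
          LinearMap.smul_apply, Module.End.one_apply, map_smul, G.ap, G.ap']
        rcases hε with rfl | rfl <;> module
      have hcm : Commute (g' * (g + ε • (1 : Module.End F V))) (g - ε • (1 : Module.End F V)) := by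
        have c1 : Commute g (g - ε • (1 : Module.End F V)) := (Commute.refl g).sub_right ((Commute.one_right g).smul_right ε)
        have c2 : Commute g' (g - ε • (1 : Module.End F V)) := cgg.symm.sub_right ((Commute.one_right g').smul_right ε)
        exact c2.mul_left (c1.add_left ((Commute.one_left _).smul_left ε))
      have hp : ∀ i, (g - g') ^ i = (g' * (g + ε • (1 : Module.End F V))) ^ i * (g - ε • (1 : Module.End F V)) ^ i := by
        intro i
        rw [hN, hcm.mul_pow]
      set x := ((g - g') ^ j) z with hx
      have hgx : g (g x) = x := by
        have : g x = g' x := sub_eq_zero.mp hz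
        rw [this, G.ap]
      have hfix : (g - ε • (1 : Module.End F V)) (x + ε • g x) = 0 := by
        simp only [LinearMap.sub_apply, map_add, LinearMap.smul_apply, Module.End.one_apply, map_smul,
          hgx]
        rcases hε with rfl | rfl <;> module
      have hrng : x + ε • g x = ((g - ε • (1 : Module.End F V)) ^ j) ((1 + ε • g) (((g' * (g + ε • (1 : Module.End F V))) ^ j) z)) := by
        have c1 : Commute (1 + ε • g) ((g - ε • (1 : Module.End F V)) ^ j) := by
          apply Commute.pow_right
          apply Commute.add_left (Commute.one_left _)
          exact ((Commute.refl g).sub_right ((Commute.one_right g).smul_right ε)).smul_left ε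
        have : x + ε • g x = (1 + ε • g) x := rfl
        rw [this, hx, hp, (hcm.pow_pow j j).eq]
        exact LinearMap.congr_fun (congrArg (· * (g' * (g + ε • (1 : Module.End F V))) ^ j) c1.eq) z
      obtain ⟨w, hw⟩ := H ε hε j hj _ (by rw [← hrng]; exact hfix)
      rw [← hrng] at hw
      set y := x + ε • g x with hy
      have hgy : g y = ε • y := by
        have := hfix
        rw [LinearMap.sub_apply, sub_eq_zero] at this
        exact this
      have hg'y : g' y = ε • y := by
        have : y = ε • g' y := by
          conv_lhs => rw [← G.ap' y, hgy, map_smul]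
        conv_rhs => rw [this, smul_smul, hee, one_smul]
      have hu : (g' * (g + ε • (1 : Module.End F V))) y = (2 : F) • y := by
        simp only [Module.End.mul_apply, LinearMap.add_apply, LinearMap.smul_apply,
          Module.End.one_apply, map_add, map_smul, hgy, hg'y]
        rcases hε with rfl | rfl <;> module
      have hup : ∀ i : ℕ, ((g' * (g + ε • (1 : Module.End F V))) ^ i) y = ((2 : F) ^ i) • y := by
        intro i
        induction i with
        | zero => simp
        | succ i ih =>
          rw [pow_succ, Module.End.mul_apply, hu, map_smul, ih, smul_smul, pow_succ, mul_comm]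
      refine ⟨((2 : F) ^ (j + 1))⁻¹ • w, ?_⟩
      rw [map_smul, hp, Module.End.mul_apply, ← hw, hup, smul_smul,
        inv_mul_cancel₀ (pow_ne_zero _ G.h2), one_smul]
    obtain ⟨w1, e1⟩ := half 1 (Or.inl rfl)
    obtain ⟨w2, e2⟩ := half (-1) (Or.inr rfl)
    refine ⟨(2 : F)⁻¹ • (w1 + w2), ?_⟩
    rw [map_smul, map_add, ← e1, ← e2]
    have : ∀ a b : V, a = (2 : F)⁻¹ • (a + (1 : F) • b + (a + (-1 : F) • b)) := by
      intro a b
      have : a + (1 : F) • b + (a + (-1 : F) • b) = (2 : F) • a := by module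
      rw [this, smul_smul, inv_mul_cancel₀ G.h2, one_smul]
    exact this _ _

lemma pstab (ν : Module.End F V) (R : Submodule F V) (hR : ∀ x ∈ R, ν x ∈ R) (q : F[X]) :
    ∀ x ∈ R, aeval ν q x ∈ R := by
  induction q using Polynomial.induction_on' with
  | add p q hp hq =>
    intro x hx
    rw [map_add]
    exact R.add_mem (hp x hx) (hq x hx)
  | monomial n a =>
    have : ∀ n : ℕ, ∀ x ∈ R, (ν ^ n) x ∈ R := by
      intro n
      induction n with
      | zero => intro x hx; exact hx
      | succ n ih =>
        intro x hx
        rw [pow_succ]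
        exact ih _ (hR x hx)
    intro x hx
    rw [aeval_monomial, Module.End.mul_apply, Module.algebraMap_end_apply]
    exact R.smul_mem _ (this n x hx)

lemma xkey (p : F[X]) (k : ℕ) : (X : F[X]) ^ k ∣ p ∨
    ∃ j < k, ∃ a b : F[X], b * p = X ^ j - a * X ^ k := by
  induction k with
  | zero => left; simp
  | succ k ih =>
    rcases ih with ⟨s, hs⟩ | ⟨j, hj, a, b, h⟩
    · by_cases hd : (X : F[X]) ∣ s
      · left
        obtain ⟨t, rfl⟩ := hd
        exact ⟨t, by rw [hs]; ring⟩
      · right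
        obtain ⟨a, b, hab⟩ := (irreducible_X (R := F)).coprime_iff_not_dvd.mpr hd
        refine ⟨k, by omega, a, b, ?_⟩
        rw [hs]
        linear_combination X ^ k * hab
    · right
      by_cases hj2 : k = 0
      · omega
      refine ⟨j, by omega, a * a * X ^ (k - j - 1), b + a * b * X ^ (k - j), ?_⟩
      have e1 : (X : F[X]) ^ k = X ^ (k - j) * X ^ j := by rw [← pow_add]; congr 1; omega
      have e2 : (X : F[X]) ^ (k - j) = X * X ^ (k - j - 1) := by
        rw [← pow_succ']; congr 1; omega
      have : (b + a * b * X ^ (k - j)) * p = (1 + a * X ^ (k - j)) * (b * p) := by ring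
      rw [this, h, pow_succ, e1, e2]
      ring

lemma dimcyc [FiniteDimensional F V] (ν : Module.End F V) (x : V) (j : ℕ)
    (h0 : (ν ^ (j + 1)) x = 0) (h1 : (ν ^ j) x ≠ 0) : finrank F (cyc ν x) = j + 1 := by
  let f : F[X] →ₗ[F] V := (LinearMap.applyₗ x) ∘ₗ (aeval ν : F[X] →ₐ[F] Module.End F V).toLinearMap
  have hf : ∀ p, f p = aeval ν p x := fun p => rfl
  have hX : ∀ p i, f (p * X ^ i) = aeval ν p ((ν ^ i) x) := by
    intro p i
    rw [hf, map_mul, map_pow, aeval_X]; rfl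
  let f' := f ∘ₗ (degreeLT F (j + 1)).subtype
  have hinj : Function.Injective f' := by
    rw [← LinearMap.ker_eq_bot, LinearMap.ker_eq_bot']
    rintro ⟨p, hp⟩ hfp
    have hfp : f p = 0 := hfp
    apply Subtype.ext
    rw [mem_degreeLT] at hp
    rcases xkey p (j + 1) with hd | ⟨i, hi, a, b, hab⟩
    · exact eq_zero_of_dvd_of_degree_lt hd (by simpa using hp)
    · exfalso
      apply h1
      have e1 : f (b * p) = 0 := by
        rw [hf, map_mul, Module.End.mul_apply, ← hf, hfp, map_zero]
      rw [hab, map_sub, hX, h0, map_zero, sub_zero, hf, map_pow, aeval_X] at e1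
      have : j = (j - i) + i := by omega
      rw [this, pow_add, Module.End.mul_apply, e1, map_zero]
  have hr : LinearMap.range f' = cyc ν x := by
    ext y
    constructor
    · rintro ⟨p, rfl⟩
      exact ⟨p, rfl⟩
    · rintro ⟨p, rfl⟩
      have hmon : (X ^ (j + 1) : F[X]).Monic := monic_X_pow _
      refine ⟨⟨p %ₘ X ^ (j + 1), ?_⟩, ?_⟩
      · rw [mem_degreeLT]
        have := degree_modByMonic_lt p hmon
        simpa using this
      · change f (p %ₘ X ^ (j + 1)) = f p
        conv_rhs => rw [← modByMonic_add_div p (X ^ (j + 1)), map_add, mul_comm, hX, h0, map_zero,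
          add_zero]
  rw [← hr, LinearMap.finrank_range_of_inj hinj, (degreeLTEquiv F (j + 1)).finrank_eq]
  simp

lemma exW [FiniteDimensional F V] (G : GI B g g') (ε : F) (hε : ε = 1 ∨ ε = -1) (j : ℕ)
    (hj : Even j) (z : V) (hz : (g - ε • (1 : Module.End F V)) (((g - ε • (1 : Module.End F V)) ^ j) z) = 0)
    (hn : ¬ ∃ w, ((g - ε • (1 : Module.End F V)) ^ j) z = ((g - ε • (1 : Module.End F V)) ^ (j + 1)) w) :
    ∃ W : Submodule F V, (∀ x ∈ W, g x ∈ W) ∧ (∀ x ∈ W, g' x ∈ W) ∧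
      (∀ x ∈ W, (∀ y ∈ W, B x y = 0) → x = 0) ∧ Odd (finrank F W) := by
  have hee : ε * ε = 1 := by rcases hε with rfl | rfl <;> ring
  have cgg : Commute g g' := by rw [Commute, SemiconjBy, G.gg, G.gg']
  set ν := g - ε • (1 : Module.End F V) with hν
  let μ := g' - ε • (1 : Module.End F V)
  have adjν : ∀ i : ℕ, ∀ x y, B ((ν ^ i) x) y = B x ((μ ^ i) y) := by
    intro i
    induction i with
    | zero => intro x y; rfl
    | succ i ih =>
      intro x y
      rw [pow_succ, Module.End.mul_apply, ih]
      have : ∀ y, B (ν x) y = B x (μ y) := by intro y; simp [ν, μ, G.adj]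
      rw [this, pow_succ']; rfl
  have hμν : μ = (-ε • g') * ν := by
    ext x
    simp only [μ, ν, LinearMap.sub_apply, Module.End.mul_apply, map_sub,
      LinearMap.smul_apply, Module.End.one_apply, map_smul, G.ap, G.ap']
    rcases hε with rfl | rfl <;> module
  have hνμ : ν = (-ε • g) * μ := by
    ext x
    simp only [μ, ν, LinearMap.sub_apply, Module.End.mul_apply, map_sub,
      LinearMap.smul_apply, Module.End.one_apply, map_smul, G.ap, G.ap']
    rcases hε with rfl | rfl <;> module
  have c1 : Commute (-ε • g') ν :=
    (cgg.symm.sub_right ((Commute.one_right g').smul_right ε)).smul_left _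
  have c2 : Commute (-ε • g) μ :=
    (cgg.sub_right ((Commute.one_right g).smul_right ε)).smul_left _
  have hμp : ∀ i, μ ^ i = (-ε • g') ^ i * ν ^ i := fun i => by rw [hμν, c1.mul_pow]
  have hνp : ∀ i, ν ^ i = (-ε • g) ^ i * μ ^ i := fun i => by
    conv_lhs => rw [hνμ, c2.mul_pow]
  have hker : ∀ w, ν w = 0 → ((-ε • g') ^ j) w = w := by
    intro w hw
    have h1 : (-ε • g') w = - w := by
      have hgw : g w = ε • w := sub_eq_zero.mp hw
      have : w = ε • g' w := by
        conv_lhs => rw [← G.ap' w, hgw, map_smul]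
      rw [LinearMap.smul_apply, neg_smul, ← this]
    have h3 : ∀ i : ℕ, ((-ε • g') ^ i) w = ((-1 : F) ^ i) • w := by
      intro i
      induction i with
      | zero => simp
      | succ i ih => rw [pow_succ, Module.End.mul_apply, h1, map_neg, ih, pow_succ]; simp
    rw [h3, hj.neg_one_pow, one_smul]
  obtain ⟨x, hx0, hx1⟩ : ∃ x, (ν ^ (j + 1)) x = 0 ∧ B x ((ν ^ j) x) ≠ 0 := by
    by_contra hcon
    push Not at hcon
    apply hn
    have hz' : (ν ^ (j + 1)) z = 0 := by rw [pow_succ']; exact hz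
    obtain ⟨w, hw⟩ := adj_range B G.nd G.hs (ν ^ (j + 1)) (μ ^ (j + 1)) (adjν _) ((ν ^ j) z) (by
      intro x hx
      have hx' : (ν ^ (j + 1)) x = 0 := by
        rw [hνp, Module.End.mul_apply, hx, map_zero]
      have e1 := hcon (x + z) (by rw [map_add, hx', hz', add_zero])
      simp only [map_add, LinearMap.add_apply, hcon x hx', hcon z hz'] at e1
      have e2 : B z ((ν ^ j) x) = B x ((ν ^ j) z) := by
        rw [G.hs, adjν, hμp, Module.End.mul_apply, hker _ hz]
      have e3 : 2 * B x ((ν ^ j) z) = 0 := by linear_combination e1 - e2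
      exact (mul_eq_zero.mp e3).resolve_left G.h2)
    exact ⟨w, hw.symm⟩
  have hxj : (ν ^ j) x ≠ 0 := by
    intro h; rw [h, map_zero] at hx1; exact hx1 rfl
  have Wν : ∀ y ∈ cyc ν x, ν y ∈ cyc ν x := by
    intro y hy
    have := SN.cyc_S X hy
    rwa [aeval_X] at this
  have gν : ∀ y, g y = ν y + ε • y := by intro y; simp [ν]
  have Wg : ∀ y ∈ cyc ν x, g y ∈ cyc ν x := by
    intro y hy
    rw [gν]
    exact Submodule.add_mem _ (Wν y hy) (Submodule.smul_mem _ _ hy)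
  have ginj : Function.Injective g := fun a b hab => by rw [← G.ap' a, hab, G.ap']
  have Wg' : ∀ y ∈ cyc ν x, g' y ∈ cyc ν x := by
    have : (cyc ν x).map g = cyc ν x := by
      apply Submodule.eq_of_le_of_finrank_eq
      · rintro _ ⟨y, hy, rfl⟩
        exact Wg y hy
      · exact (Submodule.equivMapOfInjective g ginj _).finrank_eq.symm
    intro y hy
    rw [← this] at hy
    obtain ⟨w, hw, rfl⟩ := hy
    rw [G.ap']
    exact hw
  refine ⟨cyc ν x, Wg, Wg', ?_, ?_⟩
  · intro y hy hperp
    let R : Submodule F V := B.orthogonal (cyc ν x)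
    have memR : ∀ w, w ∈ R ↔ ∀ y ∈ cyc ν x, B y w = 0 := fun w => Iff.rfl
    have Rν : ∀ w ∈ R, ν w ∈ R := by
      intro w hw
      rw [memR] at hw ⊢
      intro y hy
      have h3 : B y (ν w) = B (g' y) w - ε * B y w := by simp [ν, G.adj']
      rw [h3, hw _ (Wg' y hy), hw _ hy]; simp
    have yR : y ∈ R := by
      rw [memR]; intro w hw; rw [G.hs]; exact hperp w hw
    obtain ⟨p, rfl⟩ := mem_cyc.mp hy
    rcases xkey p (j + 1) with ⟨s, rfl⟩ | ⟨i, hi, a, b, hab⟩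
    · rw [mul_comm, map_mul, Module.End.mul_apply, map_pow, aeval_X, hx0, map_zero]
    · exfalso
      apply hx1
      have h3 := pstab ν R Rν (X ^ (j - i) * b) _ yR
      rw [SN.pmul, mul_assoc, hab, map_mul, map_sub, map_mul] at h3
      simp only [map_pow, aeval_X, Module.End.mul_apply, LinearMap.sub_apply, hx0, map_zero,
        sub_zero] at h3
      rw [← Module.End.mul_apply, ← pow_add, show j - i + i = j by omega] at h3
      exact (memR _).mp h3 x (SN.cyc_self x)
  · rw [dimcyc ν x j hx0 hxj]
    exact hj.add_one

lemma strong [FiniteDimensional F V] (G : GI B g g') (ε : F) (hε : ε = 1 ∨ ε = -1) (j : ℕ)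
    (hj : Even j) (z : V) (hz : (g - ε • (1 : Module.End F V)) (((g - ε • (1 : Module.End F V)) ^ j) z) = 0)
    (hn : ¬ ∃ w, ((g - ε • (1 : Module.End F V)) ^ j) z = ((g - ε • (1 : Module.End F V)) ^ (j + 1)) w) :
    ∃ σ : Module.End F V, (∀ x y, B (σ x) (σ y) = B x y) ∧ LinearMap.det σ = 1 ∧
      σ * σ = 1 ∧ σ * g = g' * σ := by
  obtain ⟨W, h1, h2, h3, h4⟩ := G.exW ε hε j hj z hz hn
  obtain ⟨P, M, h5, h6⟩ := evenM G.toSN W (fun x hx => W.add_mem (h1 x hx) (h2 x hx))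
    (fun x hx => W.sub_mem (h1 x hx) (h2 x hx)) h3 h4
  obtain ⟨σ, a1, a2, a3, a4, a5⟩ := invol G.toSN P M h5 h6
  refine ⟨σ, a1, a2, LinearMap.ext a3, ?_⟩
  ext x
  have e1 := a4 x
  have e2 := a5 x
  simp only [LinearMap.add_apply, LinearMap.sub_apply, map_add, map_sub] at e1 e2
  have e3 : (2 : F) • σ (g x) = (2 : F) • g' (σ x) := by
    have : (2 : F) • σ (g x) = (σ (g x) + σ (g' x)) + (σ (g x) - σ (g' x)) := by module
    rw [this, e1, e2]; module
  exact smul_right_injective V G.h2 e3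

end GI

end Helpers

/-- For odd `q` and `n ≡ 2 (mod 4)`, and `g ∈ SO_n^±(q)`: `g` is real iff `g` is
strongly real, and `g` is real iff `g` has an elementary divisor `(t ∓ 1)^k` with
`k` odd (encoded via ranks of powers of `g − ε·1`, `ε = ±1`). -/
theorem stmt_17 (p e q n : ℕ) (hp : p.Prime) (he : 0 < e) (hq : q = p ^ e)
    (hodd : Odd q) (hn : n % 4 = 2)
    (F : Type*) [Field F] [Fintype F] (hcard : Fintype.card F = q)
    (η : Matrix (Fin n) (Fin n) F) (hsym : η.transpose = η) (hηdet : IsUnit η.det)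
    (g : Matrix.GeneralLinearGroup (Fin n) F)
    (hg : (↑g : Matrix (Fin n) (Fin n) F).transpose * η *
      (↑g : Matrix (Fin n) (Fin n) F) = η)
    (hgdet : Matrix.det (↑g : Matrix (Fin n) (Fin n) F) = 1) :
    ((∃ h : Matrix.GeneralLinearGroup (Fin n) F,
        (↑h : Matrix (Fin n) (Fin n) F).transpose * η *
          (↑h : Matrix (Fin n) (Fin n) F) = η ∧
        Matrix.det (↑h : Matrix (Fin n) (Fin n) F) = 1 ∧ h * g * h⁻¹ = g⁻¹) ↔
      (∃ h : Matrix.GeneralLinearGroup (Fin n) F,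
        (↑h : Matrix (Fin n) (Fin n) F).transpose * η *
          (↑h : Matrix (Fin n) (Fin n) F) = η ∧
        Matrix.det (↑h : Matrix (Fin n) (Fin n) F) = 1 ∧ h * h = 1 ∧
        h * g * h⁻¹ = g⁻¹)) ∧
    ((∃ h : Matrix.GeneralLinearGroup (Fin n) F,
        (↑h : Matrix (Fin n) (Fin n) F).transpose * η *
          (↑h : Matrix (Fin n) (Fin n) F) = η ∧
        Matrix.det (↑h : Matrix (Fin n) (Fin n) F) = 1 ∧ h * g * h⁻¹ = g⁻¹) ↔
      ∃ ε : F, (ε = 1 ∨ ε = -1) ∧ ∃ k : ℕ, Odd k ∧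
        (((↑g : Matrix (Fin n) (Fin n) F) - ε • 1) ^ (k - 1)).rank +
            (((↑g : Matrix (Fin n) (Fin n) F) - ε • 1) ^ (k + 1)).rank ≠
          2 * (((↑g : Matrix (Fin n) (Fin n) F) - ε • 1) ^ k).rank) := by
  have h2 : (2 : F) ≠ 0 := by
    intro h
    have hch : CharP F 2 := CharTwo.of_one_ne_zero_of_two_eq_zero one_ne_zero h
    have h1 := FiniteField.even_card_of_char_two (F := F) (ringChar.eq F 2)
    rw [hcard] at h1
    rw [Nat.odd_iff] at hodd
    omega
  let B : LinearMap.BilinForm F (Fin n → F) := Matrix.toBilin' η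
  let φ : Matrix.GeneralLinearGroup (Fin n) F → Module.End F (Fin n → F) := fun h =>
    Matrix.toLinAlgEquiv' (↑h : Matrix (Fin n) (Fin n) F)
  have hiso : ∀ h : Matrix (Fin n) (Fin n) F, h.transpose * η * h = η ↔
      ∀ x y, B (Matrix.toLinAlgEquiv' h x) (Matrix.toLinAlgEquiv' h y) = B x y := by
    intro h
    have h1 := Matrix.toBilin'_comp η h h
    constructor
    · intro h3 x y
      rw [h3] at h1
      exact LinearMap.congr_fun (LinearMap.congr_fun h1 x) y
    · intro h3
      apply Matrix.toBilin'.injective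
      rw [← h1]
      ext x y
      exact h3 _ _
  have hdet : ∀ h : Matrix (Fin n) (Fin n) F,
      LinearMap.det (Matrix.toLinAlgEquiv' h : Module.End F (Fin n → F)) = h.det := fun h =>
    LinearMap.det_toLin' h
  have hmul : ∀ a b, φ (a * b) = φ a * φ b := fun a b => by simp [φ]
  have hone : φ 1 = 1 := by simp [φ]
  have G : GI B (φ g) (φ g⁻¹) :=
    { h2 := h2
      nd := by
        have hnd : B.Nondegenerate := by
          apply LinearMap.BilinForm.nondegenerate_toBilin'_of_det_ne_zero'
          exact hηdet.ne_zero
        exact hnd.1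
      hs := by
        intro x y
        simp only [B, Matrix.toBilin'_apply']
        rw [Matrix.dotProduct_mulVec, ← Matrix.mulVec_transpose, hsym, dotProduct_comm]
      iso := (hiso _).mp hg
      gg := by rw [← hmul, mul_inv_cancel, hone]
      gg' := by rw [← hmul, inv_mul_cancel, hone] }
  have hrank : ∀ (ε : F) (j : ℕ), (((↑g : Matrix (Fin n) (Fin n) F) - ε • 1) ^ j).rank =
      Module.finrank F (LinearMap.range ((φ g - ε • (1 : Module.End F (Fin n → F))) ^ j)) := by
    intro ε j
    have : (φ g - ε • (1 : Module.End F (Fin n → F))) ^ j =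
        Matrix.toLinAlgEquiv' (((↑g : Matrix (Fin n) (Fin n) F) - ε • 1) ^ j) := by
      simp only [φ, map_pow, map_sub, map_smul, map_one]
    rw [this]
    rfl
  have h13 : (∃ h : Matrix.GeneralLinearGroup (Fin n) F,
        (↑h : Matrix (Fin n) (Fin n) F).transpose * η *
          (↑h : Matrix (Fin n) (Fin n) F) = η ∧
        Matrix.det (↑h : Matrix (Fin n) (Fin n) F) = 1 ∧ h * g * h⁻¹ = g⁻¹) →
      ∃ ε : F, (ε = 1 ∨ ε = -1) ∧ ∃ k : ℕ, Odd k ∧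
        (((↑g : Matrix (Fin n) (Fin n) F) - ε • 1) ^ (k - 1)).rank +
            (((↑g : Matrix (Fin n) (Fin n) F) - ε • 1) ^ (k + 1)).rank ≠
          2 * (((↑g : Matrix (Fin n) (Fin n) F) - ε • 1) ^ k).rank := by
    rintro ⟨h, hh, hd, hc⟩
    by_contra hcon
    push Not at hcon
    have hc2 : h * g = g⁻¹ * h := by rw [← hc]; group
    have := G.detm (φ h) ((hiso _).mp hh)
      (fun x => by
        have h3 : φ h * φ g = φ g⁻¹ * φ h := by rw [← hmul, hc2, hmul]
        exact LinearMap.congr_fun h3 x)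
      (fun ε hε j hj => by
        rw [← rk2]
        have := hcon ε hε (j + 1) hj.add_one
        rw [hrank, hrank, hrank] at this
        exact this) (n / 2) (by simp; omega)
    rw [hdet, hd, Odd.neg_one_pow (Nat.odd_iff.mpr (by omega))] at this
    apply h2
    linear_combination this
  have h32 : (∃ ε : F, (ε = 1 ∨ ε = -1) ∧ ∃ k : ℕ, Odd k ∧
        (((↑g : Matrix (Fin n) (Fin n) F) - ε • 1) ^ (k - 1)).rank +
            (((↑g : Matrix (Fin n) (Fin n) F) - ε • 1) ^ (k + 1)).rank ≠
          2 * (((↑g : Matrix (Fin n) (Fin n) F) - ε • 1) ^ k).rank) →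
      ∃ h : Matrix.GeneralLinearGroup (Fin n) F,
        (↑h : Matrix (Fin n) (Fin n) F).transpose * η *
          (↑h : Matrix (Fin n) (Fin n) F) = η ∧
        Matrix.det (↑h : Matrix (Fin n) (Fin n) F) = 1 ∧ h * h = 1 ∧
        h * g * h⁻¹ = g⁻¹ := by
    rintro ⟨ε, hε, k, hk, hr⟩
    obtain ⟨j, rfl⟩ : ∃ j, k = j + 1 := ⟨k - 1, by have := hk.pos; omega⟩
    have hj : Even j := by
      rcases Nat.even_or_odd j with h | h
      · exact h
      · exact absurd h.add_one (Nat.not_even_iff_odd.mpr hk)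
    rw [hrank, hrank, hrank] at hr
    have hr2 := mt (rk2 _ j).mpr hr
    rw [not_forall] at hr2
    obtain ⟨z, hz⟩ := hr2
    rw [Classical.not_imp] at hz
    obtain ⟨σ, a1, a2, a3, a4⟩ := G.strong ε hε j hj z hz.1 hz.2
    obtain ⟨A, rfl⟩ := (Matrix.toLinAlgEquiv' (R := F) (n := Fin n)).surjective σ
    have hAA : A * A = 1 := by
      apply (Matrix.toLinAlgEquiv' (R := F) (n := Fin n)).injective
      rw [map_mul, a3, map_one]
    have hAg : A * (↑g : Matrix (Fin n) (Fin n) F) =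
        (↑g⁻¹ : Matrix (Fin n) (Fin n) F) * A := by
      apply (Matrix.toLinAlgEquiv' (R := F) (n := Fin n)).injective
      rw [map_mul, map_mul]
      exact a4
    let h : Matrix.GeneralLinearGroup (Fin n) F := ⟨A, A, hAA, hAA⟩
    refine ⟨h, (hiso A).mpr a1, by rw [← hdet]; exact a2, Units.ext hAA, ?_⟩
    have h5 : h * g = g⁻¹ * h := Units.ext hAg
    rw [h5]; group
  refine ⟨⟨fun h => h32 (h13 h), ?_⟩, ⟨h13, fun h => ?_⟩⟩
  · rintro ⟨h, b1, b2, _, b3⟩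
    exact ⟨h, b1, b2, b3⟩
  · obtain ⟨h, b1, b2, _, b3⟩ := h32 h
    exact ⟨h, b1, b2, b3⟩
end

section
/- Let q be odd, n odd or divisible by 4, and g ∈ SO_n^±(q). Then g is strongly real in SO_n^±(q), i.e., there is an involution h ∈ SO_n^±(q) with h g h⁻¹ = g⁻¹. -/
open Polynomial Module

/-- inverting involution data -/
def Good {F V : Type*} [Field F] [AddCommGroup V] [Module F V]
    (B : LinearMap.BilinForm F V) (g h : V →ₗ[F] V) : Prop :=
  (∀ x y, B (h x) (h y) = B x y) ∧ (∀ x, h (h x) = x) ∧ (∀ x, g (h (g x)) = h x)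

theorem good_of_basis {F V ι : Type*} [Field F] [AddCommGroup V] [Module F V]
    [Fintype ι] [DecidableEq ι]
    (B : LinearMap.BilinForm F V) (g : V →ₗ[F] V)
    (hnd : ∀ x, (∀ y, B x y = 0) → x = 0)
    (hg : ∀ x y, B (g x) (g y) = B x y)
    (b : Basis ι F V) (π : Equiv.Perm ι) (c : ι → F)
    (hπ : ∀ i, π (π i) = i) (hc : ∀ i, c i * c (π i) = 1)
    (hgram : ∀ i j, c i * c j * B (b (π i)) (b (π j)) = B (b i) (b j))
    (hinv : ∀ i j, c i * c j * B (g (b (π i))) (b (π j)) = B (b i) (g (b j))) :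
    ∃ h : V →ₗ[F] V, Good B g h ∧ LinearMap.det h = (∏ i, c i) * ((Equiv.Perm.sign π : ℤ) : F) := by
  set h : V →ₗ[F] V := b.constr F (fun i => c i • b (π i)) with hh
  have hb : ∀ i, h (b i) = c i • b (π i) := fun i => by rw [hh, Basis.constr_basis]
  have h1 : ∀ x y, B (h x) (h y) = B x y := by
    have : B.compl₁₂ h h = B := by
      refine b.ext fun i => b.ext fun j => ?_
      simp [hb, ← hgram i j]
      ring
    intro x y
    exact congrArg (fun (C : LinearMap.BilinForm F V) => C x y) this
  have h2 : ∀ x, h (h x) = x := by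
    have : h ∘ₗ h = LinearMap.id := by
      refine b.ext fun i => ?_
      simp [hb, hπ, smul_smul, hc]
    intro x
    exact congrArg (fun (C : V →ₗ[F] V) => C x) this
  have h3 : ∀ x y, B (g (h x)) (h y) = B x (g y) := by
    have : B.compl₁₂ (g ∘ₗ h) h = B.compl₁₂ LinearMap.id g := by
      refine b.ext fun i => b.ext fun j => ?_
      simp [hb, ← hinv i j]
      ring
    intro x y
    exact congrArg (fun (C : LinearMap.BilinForm F V) => C x y) this
  refine ⟨h, ⟨h1, h2, ?_⟩, ?_⟩
  · intro x
    rw [← sub_eq_zero]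
    apply hnd
    intro y
    rw [← h2 y, map_sub, LinearMap.sub_apply, h3, h1, hg, sub_self]
  · have e : b.det (h ∘ b) = LinearMap.det h * b.det b := b.det_comp h b
    rw [b.det_self, mul_one] at e
    rw [← e]
    have : h ∘ b = fun i => c i • (b ∘ π) i := by
      ext i; simp [hb]
    rw [this]
    have := (b.det).toMultilinearMap.map_smul_univ c (b ∘ π)
    erw [this]
    have h5 := b.det.map_perm b π
    change _ • b.det (b ∘ π) = _
    rw [h5, b.det_self]
    simp [Units.smul_def]

theorem sign_rev_even (n : ℕ) (hn : Even n) :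
    Equiv.Perm.sign (Fin.revPerm : Equiv.Perm (Fin n)) = (-1) ^ (n / 2) := by
  rw [Equiv.Perm.sign_of_pow_two_eq_one]
  · congr 2
    have : Function.fixedPoints (Fin.revPerm : Equiv.Perm (Fin n)) = ∅ := by
      ext i
      simp only [Function.mem_fixedPoints, Function.IsFixedPt, Fin.revPerm_apply, Set.mem_empty_iff_false, iff_false]
      intro h
      have := congrArg Fin.val h
      rw [Fin.val_rev] at this
      have := i.2
      obtain ⟨m, hm⟩ := hn
      omega
    have h2 : Fintype.card (Function.fixedPoints (Fin.revPerm : Equiv.Perm (Fin n))) = 0 := by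
      rw [Fintype.card_eq_zero_iff, this]
      infer_instance
    rw [h2]; simp
  · ext i; simp [pow_two]

theorem gram_shift {F V : Type*} [Field F] [AddCommGroup V] [Module F V]
    (B : LinearMap.BilinForm F V) (g : V →ₗ[F] V)
    (hg : ∀ x y, B (g x) (g y) = B x y) (m : ℕ) (x y : V) :
    B ((g ^ m) x) ((g ^ m) y) = B x y := by
  induction m with
  | zero => simp
  | succ m ih => rw [pow_succ', Module.End.mul_apply, Module.End.mul_apply, hg, ih]

theorem gram_rev {F V : Type*} [Field F] [AddCommGroup V] [Module F V]
    (B : LinearMap.BilinForm F V) (g : V →ₗ[F] V)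
    (hs : ∀ x y, B x y = B y x)
    (hg : ∀ x y, B (g x) (g y) = B x y) (v : V) (i j k l : ℕ) (h : i + k = j + l) :
    B ((g ^ i) v) ((g ^ j) v) = B ((g ^ k) v) ((g ^ l) v) := by
  have key : ∀ a b d : ℕ, B ((g ^ (a + d)) v) ((g ^ (b + d)) v) = B ((g ^ a) v) ((g ^ b) v) := by
    intro a b d
    rw [add_comm a d, add_comm b d, pow_add, pow_add, Module.End.mul_apply, Module.End.mul_apply,
      gram_shift B g hg]
  rw [← key i j l, hs ((g ^ k) v), ← key l k i, ← h, add_comm i l, add_comm k i, h]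

theorem good_cyclic {F V : Type*} [Field F] [AddCommGroup V] [Module F V] [FiniteDimensional F V]
    (B : LinearMap.BilinForm F V) (g : V →ₗ[F] V)
    (hs : ∀ x y, B x y = B y x)
    (hnd : ∀ x, (∀ y, B x y = 0) → x = 0)
    (hg : ∀ x y, B (g x) (g y) = B x y) (v : V) (hv : ∀ x, ∃ f : F[X], aeval g f v = x) :
    ∃ h : V →ₗ[F] V, Good B g h ∧ (Even (finrank F V) → LinearMap.det h = (-1) ^ (finrank F V / 2)) := by
  set n := finrank F V with hn
  have hspan : (⊤ : Submodule F V) ≤ Submodule.span F (Set.range (fun i : Fin n => (g ^ (i : ℕ)) v)) := by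
    intro x _
    obtain ⟨f, rfl⟩ := hv x
    have hmon := g.charpoly_monic
    have : aeval g f = aeval g (f %ₘ g.charpoly) := by
      conv_lhs => rw [← modByMonic_add_div f g.charpoly]
      simp [LinearMap.aeval_self_charpoly]
    rw [this]
    by_cases h0 : f %ₘ g.charpoly = 0
    · simp [h0]
    have hd : (f %ₘ g.charpoly).natDegree < n := by
      have h1 := degree_modByMonic_lt f hmon
      rw [hn, ← g.charpoly_natDegree]
      exact natDegree_lt_natDegree h0 h1
    rw [aeval_eq_sum_range' hd, LinearMap.sum_apply]
    refine Submodule.sum_mem _ fun i hi => ?_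
    rw [LinearMap.smul_apply]
    refine Submodule.smul_mem _ _ (Submodule.subset_span ⟨⟨i, by simpa using hi⟩, rfl⟩)
  let b := basisOfTopLeSpanOfCardEqFinrank _ hspan (by simp [hn])
  have hb : ∀ i : Fin n, b i = (g ^ (i : ℕ)) v := fun i => by simp [b]
  obtain ⟨h, h1, h2⟩ := good_of_basis B g hnd hg b Fin.revPerm (fun _ => 1) (by simp) (by simp)
    (by
      intro i j
      simp only [hb, Fin.revPerm_apply, Fin.val_rev, one_mul]
      apply gram_rev B g hs hg
      omega)
    (by
      intro i j
      simp only [hb, Fin.revPerm_apply, Fin.val_rev, one_mul, ← Module.End.mul_apply, ← pow_succ']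
      apply gram_rev B g hs hg
      omega)
  refine ⟨h, h1, fun he => ?_⟩
  rw [h2, sign_rev_even n he]
  simp

theorem good_combine {F V : Type*} [Field F] [AddCommGroup V] [Module F V] [FiniteDimensional F V]
    (B : LinearMap.BilinForm F V) (g : V →ₗ[F] V)
    (hs : ∀ x y, B x y = B y x)
    (W W' : Submodule F V) (hc : IsCompl W W') (ho : ∀ x ∈ W, ∀ y ∈ W', B x y = 0)
    (hW : ∀ x ∈ W, g x ∈ W) (hW' : ∀ x ∈ W', g x ∈ W')
    (h₁ : W →ₗ[F] W) (h₂ : W' →ₗ[F] W')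
    (H₁ : Good (B.restrict W) (g.restrict hW) h₁) (H₂ : Good (B.restrict W') (g.restrict hW') h₂) :
    ∃ h : V →ₗ[F] V, Good B g h ∧ LinearMap.det h = LinearMap.det h₁ * LinearMap.det h₂ := by
  let e := W.prodEquivOfIsCompl W' hc
  let h : V →ₗ[F] V := e.toLinearMap ∘ₗ (h₁.prodMap h₂) ∘ₗ e.symm.toLinearMap
  have he : ∀ x : W, ∀ y : W', h (x + y) = h₁ x + h₂ y := by
    intro x y
    have : (x + y : V) = e (x, y) := by simp [e]
    rw [this]
    simp only [h, LinearMap.comp_apply, LinearEquiv.coe_coe, LinearEquiv.symm_apply_apply]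
    simp [e]
  have hx : ∀ x : V, ∃ a : W, ∃ b : W', x = a + b := by
    intro x
    refine ⟨(e.symm x).1, (e.symm x).2, ?_⟩
    have : e (e.symm x) = x := e.apply_symm_apply x
    conv_lhs => rw [← this]
    simp [e]
  obtain ⟨a1, a2, a3⟩ := H₁
  obtain ⟨b1, b2, b3⟩ := H₂
  refine ⟨h, ⟨?_, ?_, ?_⟩, ?_⟩
  · intro x y
    obtain ⟨x1, x2, rfl⟩ := hx x
    obtain ⟨y1, y2, rfl⟩ := hx y
    rw [he, he]
    have p1 := a1 x1 y1
    have p2 := b1 x2 y2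
    simp only [LinearMap.BilinForm.restrict_apply, LinearMap.domRestrict_apply] at p1 p2
    simp only [map_add, LinearMap.add_apply]
    rw [p1, p2, ho _ (h₁ x1).2 _ (h₂ y2).2, ho _ x1.2 _ y2.2, hs (h₂ x2), hs x2 y1,
      ho _ (h₁ y1).2 _ (h₂ x2).2, ho _ y1.2 _ x2.2]
  · intro x
    obtain ⟨x1, x2, rfl⟩ := hx x
    rw [he, he, a2, b2]
  · intro x
    obtain ⟨x1, x2, rfl⟩ := hx x
    have p1 := congrArg Subtype.val (a3 x1)
    have p2 := congrArg Subtype.val (b3 x2)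
    have : g (x1 + x2) = (g.restrict hW x1 : V) + (g.restrict hW' x2 : V) := by simp
    rw [this, he, he, ← p1, ← p2]
    simp
  · rw [← LinearMap.det_prodMap]
    exact LinearMap.det_conj (h₁.prodMap h₂) e

theorem Good.neg {F V : Type*} [Field F] [AddCommGroup V] [Module F V]
    {B : LinearMap.BilinForm F V} {g h : V →ₗ[F] V} (H : Good B g h) : Good B g (-h) := by
  obtain ⟨a1, a2, a3⟩ := H
  refine ⟨?_, ?_, ?_⟩
  · intro x y; simp [a1]
  · intro x; simp [a2]
  · intro x; simp [a3]

theorem Good.det {F V : Type*} [Field F] [AddCommGroup V] [Module F V]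
    {B : LinearMap.BilinForm F V} {g h : V →ₗ[F] V} (H : Good B g h) :
    LinearMap.det h = 1 ∨ LinearMap.det h = -1 := by
  have : h ∘ₗ h = LinearMap.id := LinearMap.ext H.2.1
  have := congrArg LinearMap.det this
  rw [LinearMap.det_comp, LinearMap.det_id] at this
  exact mul_self_eq_one_iff.mp this

theorem det_neg' {F V : Type*} [Field F] [AddCommGroup V] [Module F V]
    (h : V →ₗ[F] V) : LinearMap.det (-h) = (-1) ^ (finrank F V) * LinearMap.det h := by
  have := LinearMap.det_smul (-1 : F) h
  simpa using this

/-- orthogonal indecomposability -/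
def Indec {F V : Type*} [Field F] [AddCommGroup V] [Module F V]
    (B : LinearMap.BilinForm F V) (g : V →ₗ[F] V) : Prop :=
  ∀ W : Submodule F V, (∀ x ∈ W, g x ∈ W) → (∀ x ∈ W, (∀ y ∈ W, B x y = 0) → x = 0) →
    W = ⊥ ∨ W = ⊤

theorem fitting {F V : Type*} [Field F] [AddCommGroup V] [Module F V] [FiniteDimensional F V]
    (B : LinearMap.BilinForm F V) (g : V →ₗ[F] V)
    (hnd : ∀ x, (∀ y, B x y = 0) → x = 0) (hI : Indec B g)
    (S : Module.End F V) (hS : ∀ x y, B (S x) y = B x (S y)) (hc : ∀ x, S (g x) = g (S x)) :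
    (∀ x, S x = 0 → x = 0) ∨ IsNilpotent S := by
  obtain ⟨N, hN⟩ := Filter.eventually_atTop.mp (LinearMap.eventually_isCompl_ker_pow_range_pow S)
  have hN1 := hN (N + 1) (by omega)
  have hSp : ∀ m : ℕ, ∀ x y, B ((S ^ m) x) y = B x ((S ^ m) y) := by
    intro m
    induction m with
    | zero => simp
    | succ m ih =>
      intro x y
      rw [pow_succ, Module.End.mul_apply, ih, hS, ← Module.End.mul_apply, ← pow_succ', ← pow_succ]
  have hcp : Commute S g := LinearMap.ext hc
  have q1 : ∀ x ∈ LinearMap.ker (S ^ (N + 1)), g x ∈ LinearMap.ker (S ^ (N + 1)) := by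
    intro x hx
    rw [LinearMap.mem_ker] at hx ⊢
    rw [← Module.End.mul_apply, (hcp.pow_left (N + 1)).eq, Module.End.mul_apply, hx, map_zero]
  have q2 : ∀ x ∈ LinearMap.ker (S ^ (N + 1)),
      (∀ y ∈ LinearMap.ker (S ^ (N + 1)), B x y = 0) → x = 0 := by
    intro x hx hxy
    apply hnd
    intro y
    have : y ∈ LinearMap.ker (S ^ (N + 1)) ⊔ LinearMap.range (S ^ (N + 1)) := by
      rw [hN1.sup_eq_top]; trivial
    obtain ⟨a, ha, b, ⟨z, rfl⟩, rfl⟩ := Submodule.mem_sup.mp this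
    rw [map_add, hxy a ha, ← hSp, LinearMap.mem_ker.mp hx]
    simp
  rcases hI (LinearMap.ker (S ^ (N + 1))) q1 q2 with h | h
  · left
    intro x hx
    have : x ∈ LinearMap.ker (S ^ (N + 1)) := by
      rw [LinearMap.mem_ker, pow_succ, Module.End.mul_apply, hx, map_zero]
    rw [h] at this
    simpa using this
  · right
    exact ⟨N + 1, LinearMap.ker_eq_top.mp h⟩

theorem unit_of_coprime {F A : Type*} [Field F] [Ring A] [Algebra F A] (T : A) (q f : F[X])
    (hq : Irreducible q) (k : ℕ) (hk : (aeval T q) ^ k = 0) (hf : ¬ q ∣ f) :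
    ∃ b : F[X], aeval T b * aeval T f = 1 := by
  have : IsCoprime (q ^ k) f := ((hq.coprime_iff_not_dvd).mpr hf).pow_left
  obtain ⟨a, b, hab⟩ := this
  refine ⟨b, ?_⟩
  have := congrArg (aeval T) hab
  simpa [hk] using this

theorem chain {F A : Type*} [Field F] [Ring A] [Algebra F A] (T : A) (q f : F[X])
    (hq : Irreducible q) (k : ℕ) (hk : (aeval T q) ^ (k + 1) = 0) (hf : aeval T f ≠ 0) :
    ∃ b : F[X], aeval T b * aeval T f = (aeval T q) ^ k := by
  have hf0 : f ≠ 0 := by rintro rfl; simp at hf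
  obtain ⟨j, f', hf', rfl⟩ := WfDvdMonoid.max_power_factor hf0 hq
  obtain ⟨c, hc⟩ := unit_of_coprime T q f' hq (k + 1) hk hf'
  have hj : j ≤ k := by
    by_contra h
    apply hf
    rw [map_mul, map_pow, show j = (k + 1) + (j - (k + 1)) by omega, pow_add, hk]
    simp
  refine ⟨q ^ (k - j) * c, ?_⟩
  rw [← map_mul, show q ^ (k - j) * c * (q ^ j * f') = q ^ (k - j + j) * (c * f') by ring,
    map_mul, map_mul, hc, mul_one, map_pow, Nat.sub_add_cancel hj]

theorem adj_aeval {F V : Type*} [Field F] [AddCommGroup V] [Module F V]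
    (B : LinearMap.BilinForm F V) (T T' : Module.End F V)
    (h : ∀ x y, B (T x) y = B x (T' y)) (f : F[X]) (x y : V) :
    B (aeval T f x) y = B x (aeval T' f y) := by
  have hp : ∀ m : ℕ, ∀ x y, B ((T ^ m) x) y = B x ((T' ^ m) y) := by
    intro m
    induction m with
    | zero => simp
    | succ m ih =>
      intro x y
      rw [pow_succ, Module.End.mul_apply, ih, h, ← Module.End.mul_apply, ← pow_succ']
  induction f using Polynomial.induction_on' with
  | add p q hp hq => simp [hp, hq]
  | monomial n a => simp [aeval_monomial, hp, Module.algebraMap_end_apply]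

theorem exists_inv {F V : Type*} [Field F] [AddCommGroup V] [Module F V] [FiniteDimensional F V]
    (g : Module.End F V) (hg : ∀ x, g x = 0 → x = 0) :
    ∃ r : F[X], aeval g r * g = 1 ∧ g * aeval g r = 1 := by
  have h0 : g.charpoly.coeff 0 ≠ 0 := by
    intro h
    have h1 : LinearMap.det g = 0 := by
      rw [LinearMap.det_eq_sign_charpoly_coeff, h, mul_zero]
    rw [LinearMap.det_eq_zero_iff_ker_ne_bot] at h1
    exact h1 (LinearMap.ker_eq_bot'.mpr hg)
  have h1 := LinearMap.aeval_self_charpoly g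
  rw [← divX_mul_X_add g.charpoly] at h1
  set c := g.charpoly.coeff 0
  have key : aeval g (C (-c⁻¹) * g.charpoly.divX) * g = 1 := by
    simp only [map_add, map_mul, aeval_X, aeval_C] at h1
    rw [map_mul, aeval_C, mul_assoc, eq_neg_of_add_eq_zero_left h1, ← map_neg, ← map_mul]
    simp [h0]
  refine ⟨C (-c⁻¹) * g.charpoly.divX, key, ?_⟩
  have := Polynomial.aeval_X (R := F) g
  rw [← this, aeval_X] 
  conv_lhs => lhs; rw [← aeval_X (R := F) g]
  rw [← map_mul, mul_comm, map_mul, aeval_X, key]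

theorem exists_nil {A : Type*} [Ring A] [Nontrivial A] (z : A) (hz : IsNilpotent z) :
    ∃ k : ℕ, z ^ (k + 1) = 0 ∧ z ^ k ≠ 0 := by
  classical
  have h : ∃ n, z ^ n = 0 := hz
  have h1 := Nat.find_spec h
  have h0 : Nat.find h ≠ 0 := by
    intro h0
    rw [h0, pow_zero] at h1
    exact one_ne_zero h1
  obtain ⟨k, hk⟩ := Nat.exists_eq_succ_of_ne_zero h0
  refine ⟨k, by rw [hk] at h1; exact h1, ?_⟩
  exact Nat.find_min h (by omega)

theorem polar {F V : Type*} [Field F] [AddCommGroup V] [Module F V]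
    (B : LinearMap.BilinForm F V) (S : Module.End F V) (h : ∀ v, B (S v) v = 0) (x y : V) :
    B (S x) y = - B (S y) x := by
  have := h (x + y)
  simp only [map_add, LinearMap.add_apply, h, zero_add, add_zero] at this
  rw [eq_neg_iff_add_eq_zero, ← this]
  ring

theorem exists_irr {F V : Type*} [Field F] [AddCommGroup V] [Module F V] [FiniteDimensional F V]
    [Nontrivial V] (y : Module.End F V) :
    ∃ q : F[X], Irreducible q ∧ ¬ (∀ x, aeval y q x = 0 → x = 0) := by
  have hint : IsIntegral F y := Algebra.IsIntegral.isIntegral y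
  obtain ⟨q, hq, m, hm⟩ := WfDvdMonoid.exists_irreducible_factor (minpoly.not_isUnit F y) (minpoly.ne_zero hint)
  refine ⟨q, hq, fun h => ?_⟩
  have h1 : aeval y m = 0 := by
    ext x
    apply h
    rw [← Module.End.mul_apply, ← map_mul, ← hm, minpoly.aeval]
    simp
  obtain ⟨c, hc⟩ := minpoly.dvd F y h1
  have hm0 : m ≠ 0 := by
    rintro rfl
    rw [mul_zero] at hm
    exact minpoly.ne_zero hint hm
  apply hq.not_isUnit
  have : m * (q * c) = m * 1 := by
    rw [mul_one]
    conv_rhs => rw [hc, hm]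
    ring
  exact IsUnit.of_mul_eq_one c (mul_left_cancel₀ hm0 this)

theorem case_one {F V : Type*} [Field F] [AddCommGroup V] [Module F V] [FiniteDimensional F V]
    [Nontrivial V] (h2 : (2 : F) ≠ 0)
    (B : LinearMap.BilinForm F V) (g : Module.End F V)
    (hs : ∀ x y, B x y = B y x)
    (hnd : ∀ x, (∀ y, B x y = 0) → x = 0)
    (hg : ∀ x y, B (g x) (g y) = B x y) (hI : Indec B g)
    (r : F[X]) (hr : aeval g r * g = 1) (hr' : g * aeval g r = 1)
    (hinj : ∀ x, (g - aeval g r) x = 0 → x = 0) :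
    ∃ v : V, ∀ x, ∃ f : F[X], aeval g f v = x := by
  set G := aeval g r with hG
  have ad1 : ∀ x y, B (g x) y = B x (G y) := by
    intro x y
    rw [← hg x (G y), ← Module.End.mul_apply, hr']; rfl
  have ad2 : ∀ x y, B (G x) y = B x (g y) := by
    intro x y
    rw [hs, ← ad1, hs]
  set y := g + G with hy
  set s := g - G with hsd
  have ady : ∀ a b, B (y a) b = B a (y b) := by
    intro a b
    simp only [hy, LinearMap.add_apply, map_add, ad1, ad2]; ring
  have ads : ∀ a b, B (s a) b = - B a (s b) := by
    intro a b
    simp only [hsd, LinearMap.sub_apply, map_sub, ad1, ad2]; ring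
  have hyX : y = aeval g (X + r) := by simp [hy, hG]
  have hsX : s = aeval g (X - r) := by simp [hsd, hG]
  have hfy : ∀ f : F[X], aeval y f = aeval g (f.comp (X + r)) := by
    intro f; rw [aeval_comp, ← hyX]
  have comm : ∀ a b : F[X], aeval g a * aeval g b = aeval g b * aeval g a := by
    intro a b; rw [← map_mul, mul_comm, map_mul]
  have cs : ∀ f : F[X], s * aeval y f = aeval y f * s := by
    intro f; rw [hfy, hsX, comm]
  have cg : ∀ f : F[X], g * aeval y f = aeval y f * g := by
    intro f
    have := comm X (f.comp (X + r))
    rwa [aeval_X, ← hfy] at this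
  have hss : s * s = aeval y (X ^ 2 - C 4 : F[X]) := by
    have h4 : (algebraMap F (Module.End F V)) 4 = 4 := map_ofNat _ 4
    simp only [map_sub, map_mul, aeval_X, aeval_C, h4, hsd, hy, sq, mul_add, add_mul, sub_mul, mul_sub, hr, hr']
    rw [show (4 : Module.End F V) = 1 + 1 + 1 + 1 by norm_num]
    abel
  have hgy : g = (2 : F)⁻¹ • (y + s) := by
    rw [hy, hsd, show g + G + (g - G) = (2 : F) • g by rw [two_smul]; abel, smul_smul, inv_mul_cancel₀ h2, one_smul]
  obtain ⟨q, hq, hqn⟩ := exists_irr y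
  have adz := adj_aeval B y y ady
  have hnil : IsNilpotent (aeval y q) := by
    rcases fitting B g hnd hI (aeval y q) (adz q) (fun x => by
      rw [← Module.End.mul_apply, ← cg]; rfl) with h | h
    · exact absurd h hqn
    · exact h
  obtain ⟨k, hk, hk'⟩ := exists_nil _ hnil
  obtain ⟨v, hv⟩ : ∃ v, B ((aeval y q ^ k) v) v ≠ 0 := by
    by_contra hcon
    push Not at hcon
    apply hk'
    ext a
    apply hnd
    intro b
    have p := polar B _ hcon a b
    rw [← map_pow, adz, hs] at p
    rw [← map_pow, adz, hs]
    have : (2 : F) * B (aeval y (q ^ k) b) a = 0 := by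
      rw [two_mul]; nth_rewrite 1 [p]; simp
    simpa [h2] using this
  have skew : ∀ f : F[X], B (aeval y f (s v)) v = 0 := by
    intro f
    have e : B (aeval y f (s v)) v = - B (aeval y f (s v)) v := by
      conv_lhs => rw [adz, ads, hs, ← Module.End.mul_apply, cs]
      rfl
    have : (2 : F) * B (aeval y f (s v)) v = 0 := by
      rw [two_mul]; nth_rewrite 1 [e]; simp
    simpa [h2] using this
  have zero_of : ∀ f : F[X], (∀ b : F[X], B (aeval y b (aeval y f v)) v = 0) → aeval y f = 0 := by
    intro f hf
    by_contra h0
    obtain ⟨b, hb⟩ := chain y q f hq k hk h0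
    apply hv
    rw [← hb, Module.End.mul_apply, hf]
  let L : V → F[X] →ₗ[F] V := fun u => (LinearMap.applyₗ u) ∘ₗ (aeval (R := F) y).toLinearMap
  have hL : ∀ u f, L u f = aeval y f u := fun u f => rfl
  let W := LinearMap.range (L v) ⊔ LinearMap.range (L (s v))
  have hWm : ∀ x, x ∈ W ↔ ∃ a b : F[X], x = aeval y a v + aeval y b (s v) := by
    intro x
    constructor
    · intro h
      obtain ⟨_, ⟨a, rfl⟩, _, ⟨b, rfl⟩, rfl⟩ := Submodule.mem_sup.mp h
      exact ⟨a, b, rfl⟩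
    · rintro ⟨a, b, rfl⟩
      exact Submodule.mem_sup.mpr ⟨_, ⟨a, rfl⟩, _, ⟨b, rfl⟩, rfl⟩
  have hW : W = ⊥ ∨ W = ⊤ := by
    apply hI
    · intro x hx
      obtain ⟨a, b, rfl⟩ := (hWm x).mp hx
      refine (hWm _).mpr ⟨C (2⁻¹ : F) * (X * a + b * (X ^ 2 - C 4)), C (2⁻¹ : F) * (a + X * b), ?_⟩
      simp only [map_mul, map_add (aeval y), aeval_C, aeval_X, ← hss]
      conv_lhs => rw [hgy]
      have e1 : s (aeval y a v) = aeval y a (s v) := by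
        rw [← Module.End.mul_apply, cs]; rfl
      have e2 : s (aeval y b (s v)) = aeval y b (s (s v)) := by
        rw [← Module.End.mul_apply, cs]; rfl
      simp only [Module.End.mul_apply, LinearMap.smul_apply, LinearMap.add_apply, map_add, e1, e2, Module.algebraMap_end_apply, smul_add]
      abel
    · intro x hx hxy
      obtain ⟨a, b, rfl⟩ := (hWm x).mp hx
      have ha : aeval y a = 0 := by
        apply zero_of
        intro c
        have := hxy (aeval y c v) ((hWm _).mpr ⟨c, 0, by simp⟩)
        rw [← adz, map_add, map_add, LinearMap.add_apply, ← Module.End.mul_apply _ _ (s v), ← map_mul, skew, add_zero] at this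
        exact this
      have hb : aeval y (b * (X ^ 2 - C 4)) = 0 := by
        apply zero_of
        intro c
        have := hxy (aeval y c (s v)) ((hWm _).mpr ⟨0, c, by simp⟩)
        rw [ha, ← adz, LinearMap.zero_apply, zero_add, hs, ads, neg_eq_zero, hs, ← Module.End.mul_apply s, cs,
          Module.End.mul_apply, ← Module.End.mul_apply s, cs, Module.End.mul_apply, ← Module.End.mul_apply s s, hss] at this
        rw [map_mul]
        exact this
      have hb' : aeval y b = 0 := by
        ext x
        apply hinj
        apply hinj
        rw [← Module.End.mul_apply s s, hss, ← Module.End.mul_apply, ← map_mul, mul_comm, hb]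
        rfl
      rw [ha, hb']; simp
  refine ⟨v, fun x => ?_⟩
  have hx : x ∈ W := by
    rcases hW with h | h
    · exfalso
      have : v ∈ W := (hWm _).mpr ⟨1, 0, by simp⟩
      rw [h, Submodule.mem_bot] at this
      apply hv
      rw [this]; simp
    · rw [h]; trivial
  obtain ⟨a, b, rfl⟩ := (hWm x).mp hx
  refine ⟨a.comp (X + r) + b.comp (X + r) * (X - r), ?_⟩
  rw [map_add, map_mul, ← hfy, ← hfy, ← hsX]
  rfl

theorem mem_span_pow {F V : Type*} [Field F] [AddCommGroup V] [Module F V]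
    (g : Module.End F V) (m : F[X]) (hm : m.Monic) (h0 : aeval g m = 0) (n : ℕ)
    (hn : m.natDegree = n) (hn0 : n ≠ 0) (f : F[X]) (v : V) :
    aeval g f v ∈ Submodule.span F (Set.range (fun i : Fin n => (g ^ (i : ℕ)) v)) := by
  have : aeval g f = aeval g (f %ₘ m) := by
    conv_lhs => rw [← modByMonic_add_div f m]
    simp [h0]
  rw [this]
  have hd : (f %ₘ m).natDegree < n := by
    rw [← hn]
    apply natDegree_modByMonic_lt f hm
    rintro rfl
    simp at hn
    omega
  rw [aeval_eq_sum_range' hd, LinearMap.sum_apply]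
  refine Submodule.sum_mem _ fun i hi => ?_
  rw [LinearMap.smul_apply]
  refine Submodule.smul_mem _ _ (Submodule.subset_span ⟨⟨i, by simpa using hi⟩, rfl⟩)

theorem eq_zero_of_deg {F A : Type*} [Field F] [Ring A] [Algebra F A] (T : A) (q f : F[X])
    (hq : Irreducible q) (hq1 : q.natDegree = 1) (k : ℕ) (hk : (aeval T q) ^ (k + 1) = 0)
    (hk' : (aeval T q) ^ k ≠ 0)
    (hf : aeval T f = 0) (hd : f.natDegree < k + 1) : f = 0 := by
  by_contra hf0
  obtain ⟨j, f', hf', rfl⟩ := WfDvdMonoid.max_power_factor hf0 hq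
  obtain ⟨c, hc⟩ := unit_of_coprime T q f' hq (k + 1) hk hf'
  have h0 : f' ≠ 0 := by rintro rfl; simp at hf'
  rw [natDegree_mul (pow_ne_zero _ hq.ne_zero) h0, natDegree_pow, hq1] at hd
  have : aeval T q ^ j = 0 := by
    have : aeval T c * aeval T (q ^ j * f') = aeval T q ^ j := by
      rw [← map_mul, show c * (q ^ j * f') = q ^ j * (c * f') by ring, map_mul, map_mul, hc,
        mul_one, map_pow]
    rw [← this, hf, mul_zero]
  apply hk'
  rw [show k = j + (k - j) by omega, pow_add, this, zero_mul]

theorem case_two {F V : Type*} [Field F] [AddCommGroup V] [Module F V] [FiniteDimensional F V]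
    [Nontrivial V] (h2 : (2 : F) ≠ 0)
    (B : LinearMap.BilinForm F V) (g : Module.End F V)
    (hs : ∀ x y, B x y = B y x)
    (hnd : ∀ x, (∀ y, B x y = 0) → x = 0)
    (hg : ∀ x y, B (g x) (g y) = B x y) (hI : Indec B g)
    (r : F[X]) (hr : aeval g r * g = 1) (hr' : g * aeval g r = 1)
    (ε : F) (hε : ε * ε = 1) (hnil : IsNilpotent (aeval g (X - C ε))) :
    ∃ h : V →ₗ[F] V, Good B g h ∧ (Even (finrank F V) → LinearMap.det h = (-1) ^ (finrank F V / 2)) := by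
  set G := aeval g r with hG
  have ad1 : ∀ x y, B (g x) y = B x (G y) := by
    intro x y
    rw [← hg x (G y), ← Module.End.mul_apply, hr']; rfl
  have ad2 : ∀ x y, B (G x) y = B x (g y) := by
    intro x y
    rw [hs, ← ad1, hs]
  have comm : ∀ a b : F[X], aeval g a * aeval g b = aeval g b * aeval g a := by
    intro a b; rw [← map_mul, mul_comm, map_mul]
  have adg := adj_aeval B g G ad1
  have adG := adj_aeval B G g ad2
  have hGf : ∀ f : F[X], aeval G f = aeval g (f.comp r) := by
    intro f; rw [aeval_comp]
  set q : F[X] := X - C ε with hqd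
  have hq : Irreducible q := irreducible_X_sub_C ε
  obtain ⟨k, hk, hk'⟩ := exists_nil _ hnil
  set x := aeval g q with hx
  have hxk : ∀ m, x ^ m = aeval g (q ^ m) := fun m => by rw [map_pow]
  let L : V → F[X] →ₗ[F] V := fun u => (LinearMap.applyₗ u) ∘ₗ (aeval (R := F) g).toLinearMap
  have hL : ∀ u f, L u f = aeval g f u := fun u f => rfl
  by_cases hcase : ∃ v, B ((x ^ k) v) v ≠ 0
  · obtain ⟨v, hv⟩ := hcase
    apply good_cyclic B g hs hnd hg v
    have hW : LinearMap.range (L v) = ⊥ ∨ LinearMap.range (L v) = ⊤ := by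
      apply hI
      · rintro _ ⟨f, rfl⟩
        exact ⟨X * f, by simp [hL]⟩
      · rintro _ ⟨f, rfl⟩ hf
        by_contra h0
        have h0' : aeval g f ≠ 0 := by
          intro h; apply h0; rw [hL, h]; rfl
        obtain ⟨b, hb⟩ := chain g q f hq k hk h0'
        apply hv
        rw [← hx] at hb
        rw [← hb, Module.End.mul_apply, adg, hGf]
        exact hf _ ⟨_, rfl⟩
    intro y
    rcases hW with h | h
    · exfalso
      have : v ∈ LinearMap.range (L v) := ⟨1, by simp [hL]⟩
      rw [h, Submodule.mem_bot] at this
      apply hv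
      rw [this]; simp
    · have : y ∈ LinearMap.range (L v) := by rw [h]; trivial
      exact this
  push Not at hcase
  have pol := polar B _ hcase
  -- k is odd
  have hkodd : Odd k := by
    obtain ⟨a, b, hab⟩ : ∃ a b, B ((x ^ k) a) b ≠ 0 := by
      by_contra hcon
      push Not at hcon
      apply hk'
      ext a
      exact hnd _ (hcon a)
    have e1 : g * x ^ k = ε • x ^ k := by
      have : x * x ^ k = 0 := by rw [← pow_succ', hk]
      have hxe : x = g - algebraMap F _ ε := by rw [hx, hqd, map_sub, aeval_X, aeval_C]
      nth_rewrite 1 [hxe] at this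
      rw [sub_mul, sub_eq_zero] at this
      rw [this, Algebra.smul_def]
    have e2 : G * x ^ k = ε • x ^ k := by
      have : G * (g * x ^ k) = ε • (G * x ^ k) := by rw [e1, mul_smul_comm]
      rw [← mul_assoc, hr, one_mul] at this
      nth_rewrite 2 [this]
      rw [smul_smul, hε, one_smul]
    have e3 : ∀ m, G ^ m * x ^ k = ε ^ m • x ^ k := by
      intro m
      induction m with
      | zero => simp
      | succ m ih => rw [pow_succ, mul_assoc, e2, mul_smul_comm, ih, smul_smul, pow_succ']
    have e4 : aeval G q = (-ε) • (G * x) := by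
      rw [hx, hqd]
      simp only [map_sub, aeval_X, aeval_C, mul_sub, hr]
      rw [← Algebra.commutes, ← Algebra.smul_def, smul_sub, smul_smul, neg_mul, hε, Algebra.algebraMap_eq_smul_one]
      simp [sub_eq_add_neg, add_comm]
    have cGx : Commute G x := comm r q
    have e5 : aeval G (q ^ k) = (-1 : F) ^ k • x ^ k := by
      rw [map_pow, e4, _root_.smul_pow, cGx.mul_pow, e3, smul_smul, ← mul_pow, neg_mul, hε]
    by_contra hcon
    rw [Nat.not_odd_iff_even] at hcon
    have p := pol a b
    rw [hcon.neg_one_pow, one_smul] at e5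
    rw [hxk, adg, e5, hs, ← hxk] at p
    have : (2 : F) * B ((x ^ k) b) a = 0 := by
      rw [two_mul]; nth_rewrite 1 [p]; simp
    have h3 : B ((x ^ k) b) a = 0 := by simpa [h2] using this
    apply hab
    rw [pol, h3, neg_zero]
  obtain ⟨u, hu⟩ : ∃ u, (x ^ k) u ≠ 0 := by
    by_contra hcon
    push Not at hcon
    exact hk' (LinearMap.ext hcon)
  obtain ⟨w0, hw0⟩ : ∃ w, B ((x ^ k) u) w ≠ 0 := by
    by_contra hcon
    push Not at hcon
    exact hu (hnd _ hcon)
  let φ : F[X] →ₗ[F] F := (B.flip w0) ∘ₗ (L u) -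
    (B.flip w0) ∘ₗ (LinearMap.applyₗ u) ∘ₗ (aeval (R := F) G).toLinearMap
  have hφ : ∀ f, φ f = B (aeval g f u) w0 - B (aeval G f u) w0 := fun f => rfl
  have hker : φ ∈ (LinearMap.ker (L u)).dualAnnihilator := by
    rw [Submodule.mem_dualAnnihilator]
    intro f hf
    rw [LinearMap.mem_ker, hL] at hf
    have hf0 : aeval g f = 0 := by
      by_contra h0
      obtain ⟨b, hb⟩ := chain g q f hq k hk h0
      apply hu
      rw [← hx] at hb
      rw [← hb, Module.End.mul_apply, hf, map_zero]
    have hf1 : aeval G f = 0 := by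
      ext a
      apply hnd
      intro b
      rw [adG, hf0]; simp
    rw [hφ, hf0, hf1]; simp
  rw [← LinearMap.range_dualMap_eq_dualAnnihilator_ker] at hker
  obtain ⟨ψ, hψ⟩ := hker
  have hψ' : ∀ f, ψ (aeval g f u) = φ f := fun f => by rw [← hψ]; rfl
  have hBinj : Function.Injective B := by
    rw [injective_iff_map_eq_zero]
    intro a ha
    apply hnd
    intro b
    rw [ha]; rfl
  have hBsurj : Function.Surjective B :=
    (LinearMap.injective_iff_surjective_of_finrank_eq_finrank
      (Subspace.dual_finrank_eq (K := F) (V := V)).symm).mp hBinj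
  obtain ⟨w, hw⟩ := hBsurj ψ
  have hw' : ∀ f : F[X], B (aeval g f u) w = B (aeval g f u) w0 - B (aeval G f u) w0 := by
    intro f
    rw [hs, hw, hψ', hφ]
  have hxuw : B ((x ^ k) u) w ≠ 0 := by
    have e := hw' (q ^ k)
    rw [adG, ← hxk, hs u, pol w0 u, sub_neg_eq_add, ← two_mul] at e
    rw [e]
    exact mul_ne_zero h2 hw0
  have hxwu : B ((x ^ k) w) u ≠ 0 := by
    rw [pol]; simpa using hxuw
  have hGr : aeval G r = g := by
    ext a
    rw [← sub_eq_zero]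
    apply hnd
    intro b
    rw [map_sub, LinearMap.sub_apply, adG, ← hG, ad1, sub_self]
  have odd0 : ∀ i j : ℕ, B ((g ^ i) u) ((g ^ j) w) = B ((g ^ i * G ^ j) u) w0 - B ((G ^ i * g ^ j) u) w0 := by
    intro i j
    have e := hw' (r ^ j * X ^ i)
    simp only [map_mul, map_pow, aeval_X, hGr, ← hG] at e
    have c1 : Commute g G := hr'.trans hr.symm
    have adp : ∀ a b, B ((G ^ j) a) b = B a ((g ^ j) b) := by
      intro a b
      have := adG (X ^ j) a b
      simpa using this
    rw [← adp, ← Module.End.mul_apply, e, (c1.pow_pow i j).eq, (c1.symm.pow_pow i j).eq]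
  have odd1 : ∀ i j : ℕ, B ((g ^ i) u) ((g ^ j) w) = - B ((g ^ j) u) ((g ^ i) w) := by
    intro i j
    have c1 : Commute g G := hr'.trans hr.symm
    rw [odd0, odd0, (c1.pow_pow i j).eq, (c1.symm.pow_pow i j).eq]
    ring
  have odd : ∀ i j k l : ℕ, i + k = j + l → B ((g ^ i) u) ((g ^ j) w) = - B ((g ^ k) u) ((g ^ l) w) := by
    have key : ∀ a b d : ℕ, B ((g ^ (a + d)) u) ((g ^ (b + d)) w) = B ((g ^ a) u) ((g ^ b) w) := by
      intro a b d
      rw [add_comm a d, add_comm b d, pow_add, pow_add, Module.End.mul_apply, Module.End.mul_apply,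
        gram_shift B g hg]
    intro i j k l h
    rw [← key i j l, odd1 k l, neg_neg, ← key l k i, ← h, add_comm i l, add_comm k i]
  -- independence
  have indep : ∀ a b : F[X], (∀ f : F[X], B (aeval g a u + aeval g b w) (aeval g f u) = 0) →
      (∀ f : F[X], B (aeval g a u + aeval g b w) (aeval g f w) = 0) → aeval g a = 0 ∧ aeval g b = 0 := by
    intro a b h1 h2
    have t1 : ∀ c : F[X], B (aeval g (c * a) u + aeval g (c * b) w) u = 0 := by
      intro c
      have := h1 (c.comp r)
      rw [← hGf, ← adg, map_add] at this
      rw [map_mul, map_mul]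
      exact this
    have t2 : ∀ c : F[X], B (aeval g (c * a) u + aeval g (c * b) w) w = 0 := by
      intro c
      have := h2 (c.comp r)
      rw [← hGf, ← adg, map_add] at this
      rw [map_mul, map_mul]
      exact this
    have ha : aeval g a = 0 := by
      by_contra ha
      obtain ⟨c, hc⟩ := chain g q a hq k hk ha
      rw [← map_mul, ← hx] at hc
      by_cases hb : aeval g (q * (c * b)) = 0
      · have hsoc : ∃ γ : F, aeval g (c * b) = γ • x ^ k := by
          by_cases h0 : aeval g (c * b) = 0
          · exact ⟨0, by rw [h0, zero_smul]⟩
          obtain ⟨d, hd⟩ := chain g q (c * b) hq k hk h0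
          have e : aeval g d * aeval g (c * b) = (d.eval ε) • aeval g (c * b) := by
            obtain ⟨d', hd'⟩ : q ∣ d - C (d.eval ε) := X_sub_C_dvd_sub_C_eval
            have : d = d' * q + C (d.eval ε) := by rw [mul_comm, ← hd']; ring
            conv_lhs => rw [this]
            rw [map_add, map_mul, add_mul, mul_assoc, ← map_mul _ q, hb, mul_zero, zero_add, aeval_C, Algebra.smul_def]
          rw [hd, ← hx] at e
          have hne : d.eval ε ≠ 0 := by
            intro h
            rw [h, zero_smul] at e
            exact hk' e
          exact ⟨(d.eval ε)⁻¹, by rw [e, smul_smul, inv_mul_cancel₀ hne, one_smul]⟩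
        obtain ⟨γ, hγ⟩ := hsoc
        have := t2 c
        rw [hc, hγ, LinearMap.smul_apply, map_add, map_smul, LinearMap.add_apply, LinearMap.smul_apply, hcase,
          smul_zero, add_zero] at this
        exact hxuw this
      · obtain ⟨d, hd⟩ := chain g q _ hq k hk hb
        rw [← map_mul, ← hx] at hd
        have := t1 (d * q * c)
        rw [show d * q * c * a = d * q * (c * a) by ring, show d * q * c * b = d * (q * (c * b)) by ring,
          hd, map_mul, hc, map_mul, mul_assoc, ← hx, ← pow_succ', hk, mul_zero, LinearMap.zero_apply, zero_add] at this
        exact hxwu this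
    refine ⟨ha, ?_⟩
    by_contra hb
    obtain ⟨c, hc⟩ := chain g q b hq k hk hb
    rw [← map_mul, ← hx] at hc
    have := t1 c
    rw [hc, map_mul, ha, mul_zero, LinearMap.zero_apply, zero_add] at this
    exact hxwu this
  let W := LinearMap.range (L u) ⊔ LinearMap.range (L w)
  have hWm : ∀ x, x ∈ W ↔ ∃ a b : F[X], x = aeval g a u + aeval g b w := by
    intro x
    constructor
    · intro h
      obtain ⟨_, ⟨a, rfl⟩, _, ⟨b, rfl⟩, rfl⟩ := Submodule.mem_sup.mp h
      exact ⟨a, b, rfl⟩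
    · rintro ⟨a, b, rfl⟩
      exact Submodule.mem_sup.mpr ⟨_, ⟨a, rfl⟩, _, ⟨b, rfl⟩, rfl⟩
  have hW : W = ⊥ ∨ W = ⊤ := by
    apply hI
    · intro y hy
      obtain ⟨a, b, rfl⟩ := (hWm y).mp hy
      exact (hWm _).mpr ⟨X * a, X * b, by simp⟩
    · intro y hy hyy
      obtain ⟨a, b, rfl⟩ := (hWm y).mp hy
      obtain ⟨h1, h2⟩ := indep a b (fun f => hyy _ ((hWm _).mpr ⟨f, 0, by simp⟩))
        (fun f => hyy _ ((hWm _).mpr ⟨0, f, by simp⟩))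
      rw [h1, h2]; simp
  have hWt : W = ⊤ := by
    rcases hW with h | h
    · exfalso
      have : u ∈ W := (hWm _).mpr ⟨1, 0, by simp⟩
      rw [h, Submodule.mem_bot] at this
      apply hu
      rw [this]; simp
    · exact h
  let bf : Fin (k + 1) ⊕ Fin (k + 1) → V :=
    Sum.elim (fun i => (g ^ (i : ℕ)) u) (fun i => (g ^ (i : ℕ)) w)
  have hsp : ⊤ ≤ Submodule.span F (Set.range bf) := by
    rw [← hWt]
    have hmon : (q ^ (k + 1)).Monic := (monic_X_sub_C ε).pow _
    have hdeg : (q ^ (k + 1)).natDegree = k + 1 := by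
      rw [natDegree_pow, natDegree_X_sub_C, mul_one]
    have hz : aeval g (q ^ (k + 1)) = 0 := by rw [← hxk, hk]
    intro y hy
    obtain ⟨a, b, rfl⟩ := (hWm y).mp hy
    rw [Set.Sum.elim_range, Submodule.span_union]
    exact Submodule.add_mem_sup (mem_span_pow g _ hmon hz _ hdeg (by omega) a u)
      (mem_span_pow g _ hmon hz _ hdeg (by omega) b w)
  have hli : LinearIndependent F bf := by
    rw [Fintype.linearIndependent_iff]
    intro c hc
    have hev : ∀ (c : Fin (k + 1) → F) (v : V), ∑ i, c i • (g ^ (i : ℕ)) v =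
        aeval g (∑ i, C (c i) * X ^ (i : ℕ)) v := by
      intro c v
      simp [LinearMap.sum_apply, Module.algebraMap_end_apply]
    have hdz : ∀ (c : Fin (k + 1) → F), aeval g (∑ i, C (c i) * X ^ (i : ℕ)) = 0 → ∀ i, c i = 0 := by
      intro c hc i
      have h0 := eq_zero_of_deg g q _ hq (natDegree_X_sub_C ε) k hk hk' hc (by
        rw [Nat.lt_succ_iff]
        apply natDegree_sum_le_of_forall_le
        intro i _
        exact (natDegree_C_mul_X_pow_le _ _).trans (by omega))
      have := congrArg (fun p => coeff p i) h0
      simpa [finsetSum_coeff, coeff_C_mul, coeff_X_pow, Fin.val_inj] using this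
    rw [Fintype.sum_sum_type] at hc
    simp only [bf, Sum.elim_inl, Sum.elim_inr] at hc
    rw [hev (fun i => c (Sum.inl i)), hev (fun i => c (Sum.inr i))] at hc
    obtain ⟨p1, p2⟩ := indep _ _ (fun f => by rw [hc]; simp) (fun f => by rw [hc]; simp)
    rintro (i | i)
    · exact hdz _ p1 i
    · exact hdz _ p2 i
  let b := Basis.mk hli hsp
  have hb1 : ∀ i, b (Sum.inl i) = (g ^ (i : ℕ)) u := fun i => by simp [b, bf]
  have hb2 : ∀ i, b (Sum.inr i) = (g ^ (i : ℕ)) w := fun i => by simp [b, bf]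
  have odd' : ∀ i j k l : ℕ, i + k = j + l → B ((g ^ i) w) ((g ^ j) u) = - B ((g ^ k) w) ((g ^ l) u) := by
    intro i j k l h
    rw [hs, odd j i l k (by omega), hs]
  obtain ⟨h, p1, p2⟩ := good_of_basis B g hnd hg b
    (Equiv.sumCongr Fin.revPerm Fin.revPerm) (Sum.elim (fun _ => 1) (fun _ => -1))
    (by rintro (i | i) <;> simp) (by rintro (i | i) <;> simp)
    (by
      rintro (i | i) (j | j) <;>
      simp only [Equiv.sumCongr_apply, Sum.map_inl, Sum.map_inr, hb1, hb2, Fin.revPerm_apply, Fin.val_rev, one_mul, Sum.elim_inl, Sum.elim_inr, mul_one, neg_mul, neg_neg]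
      · apply gram_rev B g hs hg
        omega
      · rw [neg_eq_iff_eq_neg]
        apply odd
        omega
      · rw [neg_eq_iff_eq_neg]
        apply odd'
        omega
      · apply gram_rev B g hs hg
        omega)
    (by
      rintro (i | i) (j | j) <;>
      simp only [Equiv.sumCongr_apply, Sum.map_inl, Sum.map_inr, hb1, hb2, Fin.revPerm_apply, Fin.val_rev, one_mul, Sum.elim_inl, Sum.elim_inr, mul_one, neg_mul, neg_neg, ← Module.End.mul_apply, ← pow_succ']
      · apply gram_rev B g hs hg
        omega
      · rw [neg_eq_iff_eq_neg]
        apply odd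
        omega
      · rw [neg_eq_iff_eq_neg]
        apply odd'
        omega
      · apply gram_rev B g hs hg
        omega)
  refine ⟨h, p1, fun _ => ?_⟩
  have hfr : finrank F V = 2 * (k + 1) := by
    rw [finrank_eq_card_basis b]; simp; ring
  have hev : Even (k + 1) := hkodd.add_one
  rw [p2, hfr, Nat.mul_div_cancel_left _ (by norm_num), hev.neg_one_pow, Equiv.Perm.sign_sumCongr]
  simp [hev.neg_one_pow]

theorem good_indec {F V : Type*} [Field F] [AddCommGroup V] [Module F V] [FiniteDimensional F V]
    [Nontrivial V] (h2 : (2 : F) ≠ 0)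
    (B : LinearMap.BilinForm F V) (g : Module.End F V)
    (hs : ∀ x y, B x y = B y x)
    (hnd : ∀ x, (∀ y, B x y = 0) → x = 0)
    (hg : ∀ x y, B (g x) (g y) = B x y) (hI : Indec B g) :
    ∃ h : V →ₗ[F] V, Good B g h ∧ (Even (finrank F V) → LinearMap.det h = (-1) ^ (finrank F V / 2)) := by
  have hginj : ∀ x, g x = 0 → x = 0 := by
    intro x hx
    apply hnd
    intro y
    rw [← hg, hx]; simp
  obtain ⟨r, hr, hr'⟩ := exists_inv g hginj
  by_cases hinj : ∀ x, (g - aeval g r) x = 0 → x = 0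
  · obtain ⟨v, hv⟩ := case_one h2 B g hs hnd hg hI r hr hr' hinj
    exact good_cyclic B g hs hnd hg v hv
  push Not at hinj
  obtain ⟨v, hv, hv0⟩ := hinj
  have hv1 : g (g v) = v := by
    rw [LinearMap.sub_apply, sub_eq_zero] at hv
    rw [hv, ← Module.End.mul_apply, hr']; rfl
  obtain ⟨ε, hε, t, ht0, ht⟩ : ∃ ε : F, ε * ε = 1 ∧ ∃ t : V, t ≠ 0 ∧ g t = ε • t := by
    by_cases h : g v + v = 0
    · exact ⟨-1, by ring, v, hv0, by rw [neg_one_smul]; exact eq_neg_of_add_eq_zero_left h⟩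
    · exact ⟨1, by ring, g v + v, h, by rw [map_add, hv1, one_smul, add_comm]⟩
  apply case_two h2 B g hs hnd hg hI r hr hr' ε hε
  set G := aeval g r with hG
  have ad1 : ∀ x y, B (g x) y = B x (G y) := by
    intro x y
    rw [← hg x (G y), ← Module.End.mul_apply, hr']; rfl
  have ad2 : ∀ x y, B (G x) y = B x (g y) := by
    intro x y
    rw [hs, ← ad1, hs]
  have hxe : aeval g (X - C ε) = g - ε • 1 := by
    rw [map_sub, aeval_X, aeval_C, Algebra.algebraMap_eq_smul_one]
  have hcomm : Commute g G := hr'.trans hr.symm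
  have hSf : g + G - (2 * ε) • (1 : Module.End F V) = G * (g - ε • 1) * (g - ε • 1) := by
    simp only [mul_sub, sub_mul, hr, mul_smul_comm, smul_mul_assoc, mul_one, one_mul, smul_sub, smul_smul, hε, one_smul]
    rw [two_mul, add_smul]
    abel
  rcases fitting B g hnd hI (g + G - (2 * ε) • (1 : Module.End F V))
    (by
      intro a b
      simp only [LinearMap.sub_apply, LinearMap.add_apply, map_sub, map_add, ad1, ad2,
        LinearMap.smul_apply, map_smul, Module.End.one_apply]
      ring)
    (by
      intro a
      have e : G (g a) = g (G a) := by
        rw [← Module.End.mul_apply, hr, ← Module.End.mul_apply, hr']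
      simp only [LinearMap.sub_apply, LinearMap.add_apply, map_sub, map_add, LinearMap.smul_apply,
        map_smul, Module.End.one_apply, e]) with h | h
  · exfalso
    apply ht0
    apply h
    rw [hSf, Module.End.mul_apply]
    have : (g - ε • (1 : Module.End F V)) t = 0 := by simp [ht]
    rw [this, map_zero]
  · rw [hxe]
    obtain ⟨N, hN⟩ := h
    have c2 : Commute G (g - ε • 1) :=
      (hcomm.symm).sub_right ((Commute.one_right G).smul_right ε)
    rw [hSf, mul_assoc, (c2.mul_right c2).mul_pow] at hN
    have hGN : g ^ N * G ^ N = 1 := by rw [← hcomm.mul_pow, hr', one_pow]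
    refine ⟨2 * N, ?_⟩
    rw [pow_mul, sq]
    calc _ = (g ^ N * G ^ N) * ((g - ε • 1) * (g - ε • 1)) ^ N := by rw [hGN, one_mul]
      _ = 0 := by rw [mul_assoc, hN, mul_zero]

theorem good_all {F : Type*} [Field F] (h2 : (2 : F) ≠ 0) (N : ℕ) :
    ∀ (V : Type _) [AddCommGroup V] [Module F V] [FiniteDimensional F V]
    (B : LinearMap.BilinForm F V) (g : Module.End F V)
    (_ : ∀ x y, B x y = B y x)
    (_ : ∀ x, (∀ y, B x y = 0) → x = 0)
    (_ : ∀ x y, B (g x) (g y) = B x y) (_ : finrank F V = N),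
    ∃ h : V →ₗ[F] V, Good B g h ∧ (Even (finrank F V) → LinearMap.det h = (-1) ^ (finrank F V / 2)) := by
  induction N using Nat.strong_induction_on with
  | _ N ih =>
  intro V _ _ _ B g hs hnd hg hN
  rcases subsingleton_or_nontrivial V with hsub | hnt
  · refine ⟨LinearMap.id, ⟨fun _ _ => rfl, fun _ => rfl, fun _ => Subsingleton.elim _ _⟩, fun _ => ?_⟩
    have h0 : finrank F V = 0 := finrank_zero_of_subsingleton
    rw [h0, LinearMap.det_id]; simp
  by_cases hI : Indec B g
  · exact good_indec h2 B g hs hnd hg hI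
  unfold Indec at hI
  push Not at hI
  obtain ⟨W, hW, hWnd, hW0, hW1⟩ := hI
  have hginj : ∀ x, g x = 0 → x = 0 := by
    intro x hx
    apply hnd
    intro y
    rw [← hg, hx]; simp
  have hrefl : B.IsRefl := fun x y h => by rw [hs, h]
  have hdis : Disjoint W (B.orthogonal W) := by
    rw [Submodule.disjoint_def]
    intro x hx hx'
    apply hWnd x hx
    intro y hy
    rw [hs]
    exact hx' y hy
  have hc := (LinearMap.BilinForm.isCompl_orthogonal_iff_disjoint hrefl).mpr hdis
  set W' := B.orthogonal W with hW'd
  have ho : ∀ x ∈ W, ∀ y ∈ W', B x y = 0 := fun x hx y hy => hy x hx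
  have hsurj : ∀ x ∈ W, ∃ y ∈ W, g y = x := by
    intro x hx
    have hi : Function.Injective (g.restrict hW) := by
      rw [injective_iff_map_eq_zero]
      intro a ha
      have := congrArg Subtype.val ha
      exact Subtype.ext (hginj _ this)
    obtain ⟨y, hy⟩ := LinearMap.surjective_of_injective hi ⟨x, hx⟩
    exact ⟨y, y.2, congrArg Subtype.val hy⟩
  have hW' : ∀ x ∈ W', g x ∈ W' := by
    intro x hx w hw
    obtain ⟨y, hy, rfl⟩ := hsurj w hw
    change B (g y) (g x) = 0
    rw [hg]
    exact ho y hy x hx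
  have hWnd' : ∀ x ∈ W', (∀ y ∈ W', B x y = 0) → x = 0 := by
    intro x hx hxy
    apply hnd
    intro y
    have : y ∈ W ⊔ W' := by rw [hc.sup_eq_top]; trivial
    obtain ⟨a, ha, b, hb, rfl⟩ := Submodule.mem_sup.mp this
    rw [map_add, hxy b hb, hs, ho a ha x hx, add_zero]
  have hdim : finrank F W + finrank F W' = finrank F V := Submodule.finrank_add_eq_of_isCompl hc
  have hp : 0 < finrank F W := by
    rw [Nat.pos_iff_ne_zero]
    intro h
    exact hW0 (Submodule.finrank_eq_zero.mp h)
  have hlt : finrank F W < finrank F V := Submodule.finrank_lt hW1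
  obtain ⟨h₁, H₁, d₁⟩ := ih (finrank F W) (by omega) W (B.restrict W) (g.restrict hW)
    (fun x y => hs x y) (fun x hx => Subtype.ext (hWnd x x.2 (fun y hy => hx ⟨y, hy⟩)))
    (fun x y => hg x y) rfl
  obtain ⟨h₂, H₂, d₂⟩ := ih (finrank F W') (by omega) W' (B.restrict W') (g.restrict hW')
    (fun x y => hs x y) (fun x hx => Subtype.ext (hWnd' x x.2 (fun y hy => hx ⟨y, hy⟩)))
    (fun x y => hg x y) rfl
  by_cases hev : Even (finrank F W)
  · obtain ⟨h, H, d⟩ := good_combine B g hs W W' hc ho hW hW' h₁ h₂ H₁ H₂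
    refine ⟨h, H, fun he => ?_⟩
    have hev' : Even (finrank F W') := by
      rw [← hdim, Nat.even_add] at he
      exact he.mp hev
    rw [d, d₁ hev, d₂ hev', ← pow_add, ← hdim]
    congr 1
    obtain ⟨a, ha⟩ := hev
    obtain ⟨b, hb⟩ := hev'
    omega
  · obtain ⟨h, H, d⟩ := good_combine B g hs W W' hc ho hW hW' h₁ h₂ H₁ H₂
    obtain ⟨h', H', d'⟩ := good_combine B g hs W W' hc ho hW hW' (-h₁) h₂ H₁.neg H₂
    rw [det_neg', (Nat.not_even_iff_odd.mp hev).neg_one_pow, neg_one_mul, neg_mul, ← d] at d'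
    have hd := H.det
    rcases neg_one_pow_eq_or F (finrank F V / 2) with e | e
    · rcases hd with hd | hd
      · exact ⟨h, H, fun _ => by rw [hd, e]⟩
      · exact ⟨h', H', fun _ => by rw [d', hd, e, neg_neg]⟩
    · rcases hd with hd | hd
      · exact ⟨h', H', fun _ => by rw [d', hd, e]⟩
      · exact ⟨h, H, fun _ => by rw [hd, e]⟩

/-- For odd `q`, with `n` odd or divisible by 4, every `g ∈ SO_n^±(q)` is
strongly real in `SO_n^±(q)`. -/
theorem stmt_18 (p e q n : ℕ) (hp : p.Prime) (he : 0 < e) (hq : q = p ^ e)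
    (hodd : Odd q) (hn : Odd n ∨ 4 ∣ n)
    (F : Type*) [Field F] [Fintype F] (hcard : Fintype.card F = q)
    (η : Matrix (Fin n) (Fin n) F) (hsym : η.transpose = η) (hηdet : IsUnit η.det)
    (g : Matrix.GeneralLinearGroup (Fin n) F)
    (hg : (↑g : Matrix (Fin n) (Fin n) F).transpose * η *
      (↑g : Matrix (Fin n) (Fin n) F) = η)
    (hgdet : Matrix.det (↑g : Matrix (Fin n) (Fin n) F) = 1) :
    ∃ h : Matrix.GeneralLinearGroup (Fin n) F,
      (↑h : Matrix (Fin n) (Fin n) F).transpose * η *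
        (↑h : Matrix (Fin n) (Fin n) F) = η ∧
      Matrix.det (↑h : Matrix (Fin n) (Fin n) F) = 1 ∧
      h * h = 1 ∧ h * g * h⁻¹ = g⁻¹ := by
  have h2 : (2 : F) ≠ 0 := by
    intro h
    have h1 : ringChar F = 2 := by
      have : ringChar F ∣ 2 := (ringChar.spec F 2).mp (by exact_mod_cast h)
      rcases (Nat.dvd_prime Nat.prime_two).mp this with h | h
      · exact absurd h (CharP.ringChar_ne_one)
      · exact h
    have := FiniteField.even_card_iff_char_two.mp h1
    rw [hcard] at this
    rw [Nat.odd_iff] at hodd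
    omega
  let B : LinearMap.BilinForm F (Fin n → F) := Matrix.toBilin' η
  have hB : ∀ x y, B x y = x ⬝ᵥ (η.mulVec y) := fun x y => Matrix.toBilin'_apply' η x y
  have hs : ∀ x y, B x y = B y x := by
    intro x y
    rw [hB, hB, Matrix.dotProduct_mulVec, dotProduct_comm, ← Matrix.mulVec_transpose, hsym]
  have hnd : ∀ x, (∀ y, B x y = 0) → x = 0 := by
    intro x hx
    have : η.mulVec x = 0 := by
      apply dotProduct_eq_zero
      intro w
      rw [dotProduct_comm, ← hB, hs, hx]
    exact Matrix.eq_zero_of_mulVec_eq_zero hηdet.ne_zero this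
  have hpres : ∀ M : Matrix (Fin n) (Fin n) F, (∀ x y, B (M.mulVec x) (M.mulVec y) = B x y) ↔
      M.transpose * η * M = η := by
    intro M
    have e : ∀ x y, B (M.mulVec x) (M.mulVec y) = Matrix.toBilin' (M.transpose * η * M) x y := by
      intro x y
      rw [hB, Matrix.toBilin'_apply', ← Matrix.mulVec_mulVec, ← Matrix.mulVec_mulVec,
        Matrix.dotProduct_mulVec x, Matrix.vecMul_transpose]
    constructor
    · intro h
      apply Matrix.toBilin'.injective
      ext x y
      simp only [LinearMap.comp_apply]
      rw [← e, h]
    · intro h x y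
      rw [e, h]
  obtain ⟨h, H, d⟩ := good_all h2 n (Fin n → F) B (Matrix.toLin' g.1) hs hnd
    (by simpa only [Matrix.toLin'_apply] using (hpres g.1).mpr hg) (by simp)
  obtain ⟨h, H, d⟩ : ∃ h : (Fin n → F) →ₗ[F] (Fin n → F), Good B (Matrix.toLin' g.1) h ∧ LinearMap.det h = 1 := by
    rcases hn with hn | hn
    · rcases H.det with h1 | h1
      · exact ⟨h, H, h1⟩
      · refine ⟨-h, H.neg, ?_⟩
        rw [det_neg', h1, finrank_fin_fun, hn.neg_one_pow]
        ring
    · obtain ⟨m, rfl⟩ := hn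
      refine ⟨h, H, ?_⟩
      rw [d (by rw [finrank_fin_fun]; exact ⟨2 * m, by ring⟩), finrank_fin_fun,
        show 4 * m / 2 = 2 * m by omega, pow_mul]
      simp
  obtain ⟨a1, a2, a3⟩ := H
  obtain ⟨M, rfl⟩ := Matrix.toLin'.surjective h
  have hMM : M * M = 1 := by
    apply Matrix.toLin'.injective
    rw [Matrix.toLin'_mul, Matrix.toLin'_one]
    exact LinearMap.ext a2
  have hgMg : g.1 * M * g.1 = M := by
    apply Matrix.toLin'.injective
    rw [Matrix.toLin'_mul, Matrix.toLin'_mul]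
    exact LinearMap.ext a3
  let hu : Matrix.GeneralLinearGroup (Fin n) F := ⟨M, M, hMM, hMM⟩
  have e1 : hu * hu = 1 := Units.ext hMM
  have e2 : g * hu * g = hu := Units.ext hgMg
  refine ⟨hu, (hpres M).mp a1, ?_, e1, ?_⟩
  · rw [← d, LinearMap.det_toLin']
  · rw [mul_inv_eq_iff_eq_mul, eq_inv_mul_iff_mul_eq, ← mul_assoc, e2]
end
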